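/- arXiv:2502.08046 — 4 statements merged into one kernel-verified Lean document; each statement's English description precedes it below -/
import Mathlib

section
/- Let r = 3, let m → ∞ and let d = d(m) be integers with 2 ≤ d and d = o(m). Set M = ⌊8d²/m + log m⌋. Then, with probability 1 − o(1), a uniformly random configuration (σ₂, σ₃) ∈ S_{md} × S_{md} satisfies both: (a) there are no three distinct indices i, j, k ∈ Fin(md) whose edges coincide (i.e., whose triples (v(·), v(σ₂(·)), v(σ₃(·))) are all equal); and (b) the number of unordered pairs {i, j} of distinct indices with equal edges is at most M. -/
open Filter Asymptotics

/-- The vertex map of the configuration model: spine `s` is attached to vertex `⌊s/d⌋`. -/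
def vmap {m d : ℕ} (s : Fin (m * d)) : Fin m :=
  ⟨s.val / d, Nat.div_lt_of_lt_mul (by simp [Nat.mul_comm])⟩

/-- The `i`-th edge of the configuration `(σ₂, σ₃)` (case `r = 3`):
`(v(i), v(σ₂ i), v(σ₃ i)) ∈ (Fin m)³`. -/
def edge3 {m d : ℕ} (σ : Equiv.Perm (Fin (m * d)) × Equiv.Perm (Fin (m * d)))
    (i : Fin (m * d)) : Fin m × Fin m × Fin m :=
  (vmap i, vmap (σ.1 i), vmap (σ.2 i))

/-- `M = ⌊8d²/m + log m⌋`. -/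
noncomputable def Mbound (m d : ℕ) : ℕ :=
  Nat.floor (8 * (d : ℝ) ^ 2 / (m : ℝ) + Real.log m)

namespace MultipleEdges

open Finset

section DoubleCounting

variable {G X : Type*} [Group G] [Fintype G] [MulAction G X] [DecidableEq X]

/-- If `G` acts transitively on `S`, a random element of `G` sends a point of `S` to a uniformly
distributed point of `S`. -/
theorem card_smul_mem_mul_card {S T : Finset X} (hS : ∀ (g : G), ∀ x ∈ S, g • x ∈ S)
    (hT : T ⊆ S) (htr : ∀ x ∈ S, ∀ y ∈ S, ∃ g : G, g • x = y) {x : X} (hx : x ∈ S) :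
    #{g : G | g • x ∈ T} * #S = Fintype.card G * #T := by
  have key := sum_card_bipartiteAbove_eq_sum_card_bipartiteBelow
    (s := S) (t := (univ : Finset G)) (fun y g => g • y ∈ T)
  have hl : ∀ y ∈ S, #(bipartiteAbove (fun y (g : G) => g • y ∈ T) univ y)
      = #{g : G | g • x ∈ T} := by
    intro y hy
    obtain ⟨h, rfl⟩ := htr x hx y hy
    refine card_bij' (fun g _ => g * h) (fun g _ => g * h⁻¹) ?_ ?_ ?_ ?_ <;>
      simp [bipartiteAbove, mul_smul]
  have hr : ∀ g ∈ (univ : Finset G), #(bipartiteBelow (fun y (g : G) => g • y ∈ T) S g) = #T := by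
    intro g _
    refine card_bij' (fun y _ => g • y) (fun y _ => g⁻¹ • y) ?_ ?_ ?_ ?_
    · simp [bipartiteBelow]
    · intro y hy
      simpa [bipartiteBelow, hy] using hS g⁻¹ y (hT hy)
    · simp
    · simp
  rw [sum_congr rfl hl, sum_congr rfl hr] at key
  simpa [mul_comm] using key

/-- Joint version of `card_smul_mem_mul_card` for two independent elements of `G`, summed over
`T`. -/
theorem sum_card_filter_smul_mem {S T : Finset X} (hS : ∀ (g : G), ∀ x ∈ S, g • x ∈ S)
    (hT : T ⊆ S) (htr : ∀ x ∈ S, ∀ y ∈ S, ∃ g : G, g • x = y) :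
    (∑ σ : G × G, #{x ∈ T | σ.1 • x ∈ T ∧ σ.2 • x ∈ T}) * #S ^ 2
      = #T ^ 3 * Fintype.card G ^ 2 := by
  have key := sum_card_bipartiteAbove_eq_sum_card_bipartiteBelow
    (s := T) (t := (univ : Finset (G × G))) (fun x σ => σ.1 • x ∈ T ∧ σ.2 • x ∈ T)
  have hl : ∀ x ∈ T, #(bipartiteAbove (fun x (σ : G × G) => σ.1 • x ∈ T ∧ σ.2 • x ∈ T) univ x)
      * #S ^ 2 = (Fintype.card G * #T) ^ 2 := by
    intro x hx
    rw [← card_smul_mem_mul_card hS hT htr (hT hx), mul_pow, sq #{g : G | g • x ∈ T},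
      ← card_product]
    congr 2
    ext
    simp [bipartiteAbove]
  have : ∑ σ : G × G, #{x ∈ T | σ.1 • x ∈ T ∧ σ.2 • x ∈ T}
      = ∑ x ∈ T, #(bipartiteAbove (fun x (σ : G × G) => σ.1 • x ∈ T ∧ σ.2 • x ∈ T) univ x) :=
    key.symm
  rw [this, sum_mul, sum_congr rfl hl]
  simp only [sum_const, smul_eq_mul]
  ring

end DoubleCounting

theorem exists_perm_apply_eq {α : Type*} {k : ℕ} {x y : Fin k → α} (hx : x.Injective)
    (hy : y.Injective) : ∃ g : Equiv.Perm α, ∀ i, g (x i) = y i := by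
  obtain ⟨g, hg⟩ := (Equiv.Perm.isMultiplyPretransitive α k).exists_smul_eq ⟨x, hx⟩ ⟨y, hy⟩
  exact ⟨g, fun i => DFunLike.congr_fun hg i⟩

/-- Count pairs by summing over the fibres of the first projection. -/
theorem card_filter_fiber {X α : Type*} [Fintype X] [DecidableEq X] [Fintype α]
    (A : Finset X) (P : X → α → Prop) [∀ x, DecidablePred (P x)] :
    #{p : X × α | p.1 ∈ A ∧ P p.1 p.2} = ∑ x ∈ A, #{z | P x z} := by
  simp only [card_filter, Fintype.sum_prod_type, ite_and]
  rw [← sum_subset (subset_univ A) fun x _ hx => by simp [hx]]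
  exact sum_congr rfl fun x hx => by simp [hx]

section Tuples

variable {α β : Type*} [Fintype α] [DecidableEq α] [DecidableEq β]

/-- Ordered pairs of distinct points with the same image under `e`. -/
def coincidentPairs (e : α → β) : Finset (α × α) :=
  {p | p.1 ≠ p.2 ∧ e p.2 = e p.1}

/-- Ordered triples of distinct points with the same image under `e`. -/
def coincidentTriples (e : α → β) : Finset ((α × α) × α) :=
  {p | p.1 ∈ coincidentPairs e ∧ p.2 ≠ p.1.1 ∧ p.2 ≠ p.1.2 ∧ e p.2 = e p.1.1}

/-- Ordered pairs of disjoint coincident pairs. -/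
def coincidentQuads (e : α → β) : Finset (((α × α) × α) × α) :=
  {p | (p.1.1 ∈ coincidentPairs e ∧ p.1.2 ≠ p.1.1.1 ∧ p.1.2 ≠ p.1.1.2) ∧
    p.2 ≠ p.1.1.1 ∧ p.2 ≠ p.1.1.2 ∧ p.2 ≠ p.1.2 ∧ e p.2 = e p.1.2}

theorem card_coincidentPairs {v : α → β} {k : ℕ} (hv : ∀ x, #{z | v z = v x} = k) :
    #(coincidentPairs v) = Fintype.card α * (k - 1) := by
  have h := card_filter_fiber (univ : Finset α) (fun x z => x ≠ z ∧ v z = v x)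
  simp only [mem_univ, true_and] at h
  rw [coincidentPairs, h]
  have : ∀ x ∈ (univ : Finset α), #{z | x ≠ z ∧ v z = v x} = k - 1 := by
    intro x _
    rw [← hv x, ← card_erase_of_mem (a := x) (by simp)]
    congr 1
    ext z
    simp [eq_comm]
  simp [sum_congr rfl this]

theorem card_coincidentTriples {v : α → β} {k : ℕ} (hv : ∀ x, #{z | v z = v x} = k) :
    #(coincidentTriples v) = Fintype.card α * (k - 1) * (k - 2) := by
  rw [coincidentTriples, card_filter_fiber (coincidentPairs v)
    (fun p z => z ≠ p.1 ∧ z ≠ p.2 ∧ v z = v p.1), ← card_coincidentPairs hv]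
  have : ∀ p ∈ coincidentPairs v, #{z | z ≠ p.1 ∧ z ≠ p.2 ∧ v z = v p.1} = k - 2 := by
    intro p hp
    simp only [coincidentPairs, mem_filter, mem_univ, true_and] at hp
    rw [← hv p.1, show #{z | v z = v p.1} - 2 = #{z | v z = v p.1} - 1 - 1 by omega,
      ← card_erase_of_mem (a := p.1) (by simp),
      ← card_erase_of_mem (a := p.2) (by simp [hp.2, hp.1.symm])]
    congr 1
    ext z
    simp
    tauto
  simp [sum_congr rfl this]

theorem card_coincidentQuads_prefix {v : α → β} {k : ℕ} (hv : ∀ x, #{z | v z = v x} = k) :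
    #{p : (α × α) × α | p.1 ∈ coincidentPairs v ∧ p.2 ≠ p.1.1 ∧ p.2 ≠ p.1.2}
      = Fintype.card α * (k - 1) * (Fintype.card α - 2) := by
  rw [card_filter_fiber (coincidentPairs v) (fun p z => z ≠ p.1 ∧ z ≠ p.2),
    ← card_coincidentPairs hv]
  have : ∀ p ∈ coincidentPairs v, #{z | z ≠ p.1 ∧ z ≠ p.2} = Fintype.card α - 2 := by
    intro p hp
    simp only [coincidentPairs, mem_filter, mem_univ, true_and] at hp
    rw [← card_pair hp.1, ← card_compl]
    congr 1
    ext z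
    simp
  simp [sum_congr rfl this]

theorem card_coincidentQuads_le {v : α → β} {k : ℕ} (hv : ∀ x, #{z | v z = v x} = k) :
    #(coincidentQuads v) ≤ Fintype.card α * (k - 1) * (Fintype.card α - 2) * (k - 1) := by
  rw [← card_coincidentQuads_prefix hv, coincidentQuads]
  have h := card_filter_fiber
    {p : (α × α) × α | p.1 ∈ coincidentPairs v ∧ p.2 ≠ p.1.1 ∧ p.2 ≠ p.1.2}
    (fun p z => z ≠ p.1.1 ∧ z ≠ p.1.2 ∧ z ≠ p.2 ∧ v z = v p.2)
  simp only [mem_filter, mem_univ, true_and] at h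
  rw [h]
  refine (sum_le_card_nsmul _ _ (k - 1) fun p _ => ?_).trans_eq (smul_eq_mul _ _)
  rw [← hv p.2, ← card_erase_of_mem (a := p.2) (by simp)]
  refine card_le_card fun z => ?_
  simp +contextual

theorem card_coincidentQuads_const : #(coincidentQuads fun _ : α => ())
    = Fintype.card α * (Fintype.card α - 1) * (Fintype.card α - 2) * (Fintype.card α - 3) := by
  rw [← card_coincidentQuads_prefix (v := fun _ : α => ()) (by simp), coincidentQuads]
  have h := card_filter_fiber
    {p : (α × α) × α | p.1 ∈ coincidentPairs (fun _ : α => ()) ∧ p.2 ≠ p.1.1 ∧ p.2 ≠ p.1.2}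
    (fun p z => z ≠ p.1.1 ∧ z ≠ p.1.2 ∧ z ≠ p.2 ∧ () = ())
  simp only [mem_filter, mem_univ, true_and, and_true] at h ⊢
  rw [h]
  refine (sum_const_nat fun p hp => ?_)
  simp only [coincidentPairs, mem_filter, mem_univ, true_and] at hp
  rw [← card_eq_three.2 ⟨p.1.1, p.1.2, p.2, hp.1.1, hp.2.1.symm, hp.2.2.symm, rfl⟩, ← card_compl]
  congr 1
  ext z
  simp

/-- Two coincident pairs agree up to a swap, share exactly one point, or are disjoint. -/
theorem sq_card_coincidentPairs_le (e : α → β) :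
    #(coincidentPairs e) ^ 2 ≤
      2 * #(coincidentPairs e) + 4 * #(coincidentTriples e) + #(coincidentQuads e) := by
  rw [sq, ← card_product]
  have hsub : coincidentPairs e ×ˢ coincidentPairs e ⊆
      (coincidentPairs e).image (fun p => (p, p)) ∪
      (coincidentPairs e).image (fun p => (p, p.swap)) ∪
      (coincidentTriples e).image (fun p => (p.1, (p.1.1, p.2))) ∪
      (coincidentTriples e).image (fun p => (p.1, (p.2, p.1.1))) ∪
      (coincidentTriples e).image (fun p => (p.1, (p.1.2, p.2))) ∪
      (coincidentTriples e).image (fun p => (p.1, (p.2, p.1.2))) ∪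
      (coincidentQuads e).image (fun p => (p.1.1, (p.1.2, p.2))) := by
    rintro ⟨⟨i, j⟩, ⟨k, l⟩⟩ h
    simp only [coincidentPairs, mem_product, mem_filter, mem_univ, true_and] at h
    obtain ⟨⟨hij, hji⟩, hkl, hlk⟩ := h
    have hcases : (k = i ∧ l = j) ∨ (k = j ∧ l = i) ∨ (k = i ∧ l ≠ i ∧ l ≠ j) ∨
        (l = i ∧ k ≠ i ∧ k ≠ j) ∨ (k = j ∧ l ≠ i ∧ l ≠ j) ∨ (l = j ∧ k ≠ i ∧ k ≠ j) ∨
        ((k ≠ i ∧ k ≠ j) ∧ l ≠ i ∧ l ≠ j) := by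
      grind
    simp only [mem_union, mem_image, coincidentQuads, coincidentTriples, coincidentPairs,
      mem_filter, mem_univ, true_and]
    rcases hcases with ⟨rfl, rfl⟩ | ⟨rfl, rfl⟩ | ⟨rfl, h⟩ | ⟨rfl, h⟩ | ⟨rfl, h⟩ | ⟨rfl, h⟩ | h
    · exact Or.inl <| Or.inl <| Or.inl <| Or.inl <| Or.inl <| Or.inl
        ⟨(k, l), ⟨hij, hji⟩, rfl⟩
    · exact Or.inl <| Or.inl <| Or.inl <| Or.inl <| Or.inl <| Or.inr
        ⟨(l, k), ⟨hij, hji⟩, rfl⟩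
    · exact Or.inl <| Or.inl <| Or.inl <| Or.inl <| Or.inr
        ⟨((k, j), l), ⟨⟨hij, hji⟩, h.1, h.2, hlk⟩, rfl⟩
    · exact Or.inl <| Or.inl <| Or.inl <| Or.inr
        ⟨((l, j), k), ⟨⟨hij, hji⟩, h.1, h.2, hlk.symm⟩, rfl⟩
    · exact Or.inl <| Or.inl <| Or.inr
        ⟨((i, k), l), ⟨⟨hij, hji⟩, h.1, h.2, hlk.trans hji⟩, rfl⟩
    · exact Or.inl <| Or.inr
        ⟨((i, l), k), ⟨⟨hij, hji⟩, h.1, h.2, hlk.symm.trans hji⟩, rfl⟩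
    · exact Or.inr ⟨(((i, j), k), l), ⟨⟨⟨hij, hji⟩, h.1⟩, h.2.1, h.2.2, hkl.symm, hlk⟩, rfl⟩
  have h1 := card_image_le (s := coincidentPairs e) (f := fun p => (p, p))
  have h2 := card_image_le (s := coincidentPairs e) (f := fun p => (p, p.swap))
  have h3 := card_image_le (s := coincidentTriples e) (f := fun p => (p.1, (p.1.1, p.2)))
  have h4 := card_image_le (s := coincidentTriples e) (f := fun p => (p.1, (p.2, p.1.1)))
  have h5 := card_image_le (s := coincidentTriples e) (f := fun p => (p.1, (p.1.2, p.2)))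
  have h6 := card_image_le (s := coincidentTriples e) (f := fun p => (p.1, (p.2, p.1.2)))
  have h7 := card_image_le (s := coincidentQuads e) (f := fun p => (p.1.1, (p.1.2, p.2)))
  refine (card_le_card hsub).trans ?_
  refine (card_union_le _ _).trans ?_
  refine (Nat.add_le_add_right (card_union_le _ _) _).trans ?_
  refine (Nat.add_le_add_right (Nat.add_le_add_right (card_union_le _ _) _) _).trans ?_
  have h8 := card_union_le ((coincidentPairs e).image (fun p => (p, p)) ∪
      (coincidentPairs e).image (fun p => (p, p.swap)) ∪
      (coincidentTriples e).image (fun p => (p.1, (p.1.1, p.2))))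
      ((coincidentTriples e).image (fun p => (p.1, (p.2, p.1.1))))
  have h9 := card_union_le ((coincidentPairs e).image (fun p => (p, p)) ∪
      (coincidentPairs e).image (fun p => (p, p.swap)))
      ((coincidentTriples e).image (fun p => (p.1, (p.1.1, p.2))))
  have h10 := card_union_le ((coincidentPairs e).image (fun p => (p, p)))
      ((coincidentPairs e).image (fun p => (p, p.swap)))
  omega

end Tuples

section RandomPermutations

variable {α β : Type*} [Fintype α] [DecidableEq α] [DecidableEq β]

theorem sum_card_coincidentPairs (v : α → β) :
    (∑ σ : Equiv.Perm α × Equiv.Perm α,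
        #(coincidentPairs fun i => (v i, v (σ.1 i), v (σ.2 i)))) *
        #(coincidentPairs fun _ : α => ()) ^ 2
      = #(coincidentPairs v) ^ 3 * (Fintype.card α).factorial ^ 2 := by
  rw [← Fintype.card_perm, ← sum_card_filter_smul_mem (G := Equiv.Perm α)
    (S := coincidentPairs fun _ : α => ()) (T := coincidentPairs v)]
  · congr 2 with σ
    congr 1 with x
    simp [coincidentPairs]
    tauto
  · simp [coincidentPairs]
  · intro x
    simp +contextual [coincidentPairs]
  · rintro ⟨a, b⟩ hx ⟨a', b'⟩ hy
    simp only [coincidentPairs, mem_filter, mem_univ, true_and, and_true] at hx hy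
    obtain ⟨g, hg⟩ := exists_perm_apply_eq (x := ![a, b]) (y := ![a', b'])
      (by simpa [Function.Injective, Fin.forall_fin_succ, eq_comm] using hx)
      (by simpa [Function.Injective, Fin.forall_fin_succ, eq_comm] using hy)
    exact ⟨g, by simpa [Fin.forall_fin_succ] using hg⟩

theorem sum_card_coincidentTriples (v : α → β) :
    (∑ σ : Equiv.Perm α × Equiv.Perm α,
        #(coincidentTriples fun i => (v i, v (σ.1 i), v (σ.2 i)))) *
        #(coincidentTriples fun _ : α => ()) ^ 2
      = #(coincidentTriples v) ^ 3 * (Fintype.card α).factorial ^ 2 := by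
  rw [← Fintype.card_perm, ← sum_card_filter_smul_mem (G := Equiv.Perm α)
    (S := coincidentTriples fun _ : α => ()) (T := coincidentTriples v)]
  · congr 2 with σ
    congr 1 with x
    simp [coincidentPairs, coincidentTriples]
    tauto
  · simp [coincidentPairs, coincidentTriples]
  · intro x
    simp +contextual [coincidentPairs, coincidentTriples]
  · rintro ⟨⟨a, b⟩, c⟩ hx ⟨⟨a', b'⟩, c'⟩ hy
    simp only [coincidentPairs, coincidentTriples, mem_filter, mem_univ, true_and,
      and_true] at hx hy
    obtain ⟨g, hg⟩ := exists_perm_apply_eq (x := ![a, b, c]) (y := ![a', b', c'])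
      (by simp [Function.Injective, Fin.forall_fin_succ]; grind)
      (by simp [Function.Injective, Fin.forall_fin_succ]; grind)
    exact ⟨g, by simpa [Fin.forall_fin_succ, and_assoc] using hg⟩

theorem sum_card_coincidentQuads (v : α → β) :
    (∑ σ : Equiv.Perm α × Equiv.Perm α,
        #(coincidentQuads fun i => (v i, v (σ.1 i), v (σ.2 i)))) *
        #(coincidentQuads fun _ : α => ()) ^ 2
      = #(coincidentQuads v) ^ 3 * (Fintype.card α).factorial ^ 2 := by
  rw [← Fintype.card_perm, ← sum_card_filter_smul_mem (G := Equiv.Perm α)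
    (S := coincidentQuads fun _ : α => ()) (T := coincidentQuads v)]
  · congr 2 with σ
    congr 1 with x
    simp [coincidentPairs, coincidentQuads]
    tauto
  · simp [coincidentPairs, coincidentQuads]
  · intro x
    simp +contextual [coincidentPairs, coincidentQuads]
  · rintro ⟨⟨⟨a, b⟩, c⟩, e⟩ hx ⟨⟨⟨a', b'⟩, c'⟩, e'⟩ hy
    simp only [coincidentPairs, coincidentQuads, mem_filter, mem_univ, true_and,
      and_true] at hx hy
    obtain ⟨g, hg⟩ := exists_perm_apply_eq (x := ![a, b, c, e]) (y := ![a', b', c', e'])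
      (by simp [Function.Injective, Fin.forall_fin_succ]; grind)
      (by simp [Function.Injective, Fin.forall_fin_succ]; grind)
    exact ⟨g, by simpa [Fin.forall_fin_succ, and_assoc] using hg⟩

variable {v : α → β} {m d : ℕ}

/-- The expected number of ordered coincident pairs. -/
theorem sum_card_coincidentPairs_eq (hv : ∀ x, #{z | v z = v x} = d)
    (hα : Fintype.card α = m * d) (hd : 2 ≤ d) (hm : 2 ≤ m) :
    ∑ σ : Equiv.Perm α × Equiv.Perm α,
        (#(coincidentPairs fun i => (v i, v (σ.1 i), v (σ.2 i))) : ℝ)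
      = (m * d) * (d - 1) ^ 3 / (m * d - 1) ^ 2 * ((m * d).factorial : ℝ) ^ 2 := by
  have h := sum_card_coincidentPairs v
  rw [card_coincidentPairs hv, card_coincidentPairs (v := fun _ : α => ())
    (k := Fintype.card α) (by simp), hα] at h
  have hn : 4 ≤ m * d := Nat.mul_le_mul hm hd
  have hnR : (4 : ℝ) ≤ m * d := by exact_mod_cast hn
  have h' := congrArg (Nat.cast (R := ℝ)) h
  push_cast [Nat.cast_sub (show 1 ≤ d by omega), Nat.cast_sub (show 1 ≤ m * d by omega)] at h'
  have h1 : (m * d - 1 : ℝ) ≠ 0 := by linarith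
  have h0 : (m * d : ℝ) ≠ 0 := by linarith
  rw [div_mul_eq_mul_div, eq_div_iff (pow_ne_zero _ h1)]
  refine mul_right_cancel₀ (pow_ne_zero 2 h0) ?_
  linear_combination h'

theorem sum_card_coincidentTriples_le (hv : ∀ x, #{z | v z = v x} = d)
    (hα : Fintype.card α = m * d) (hd : 2 ≤ d) (hm : 2 ≤ m) :
    ∑ σ : Equiv.Perm α × Equiv.Perm α,
        (#(coincidentTriples fun i => (v i, v (σ.1 i), v (σ.2 i))) : ℝ)
      ≤ ((d : ℝ) / m) ^ 3 * ((m * d).factorial : ℝ) ^ 2 := by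
  have h := sum_card_coincidentTriples v
  rw [card_coincidentTriples hv, card_coincidentTriples (v := fun _ : α => ())
    (k := Fintype.card α) (by simp), hα] at h
  have hn : 4 ≤ m * d := Nat.mul_le_mul hm hd
  have hnR : (4 : ℝ) ≤ m * d := by exact_mod_cast hn
  have hmR : (2 : ℝ) ≤ m := by exact_mod_cast hm
  have hdR : (2 : ℝ) ≤ d := by exact_mod_cast hd
  have h' := congrArg (Nat.cast (R := ℝ)) h
  push_cast [Nat.cast_sub (show 1 ≤ d by omega), Nat.cast_sub (show 1 ≤ m * d by omega),
    Nat.cast_sub hd, Nat.cast_sub (show 2 ≤ m * d by omega)] at h'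
  set N := ((m * d).factorial : ℝ) ^ 2
  set s := ∑ σ : Equiv.Perm α × Equiv.Perm α,
        (#(coincidentTriples fun i => (v i, v (σ.1 i), v (σ.2 i))) : ℝ)
  have hN : 0 ≤ N := by positivity
  have h1 : (0 : ℝ) < m * d - 1 := by linarith
  have h2 : (0 : ℝ) < m * d - 2 := by linarith
  have e1 : m * ((d : ℝ) - 1) ≤ m * d - 1 := by linarith
  have e2 : m * ((d : ℝ) - 2) ≤ m * d - 2 := by linarith
  have e3 : m ^ 2 * (((d : ℝ) - 1) * (d - 2)) ≤ (m * d - 1) * (m * d - 2) := by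
    calc m ^ 2 * (((d : ℝ) - 1) * (d - 2)) = (m * ((d : ℝ) - 1)) * (m * (d - 2)) := by ring
      _ ≤ _ := mul_le_mul e1 e2 (by apply mul_nonneg <;> linarith) h1.le
  set q := ((d : ℝ) - 1) * (d - 2)
  set r := ((m : ℝ) * d - 1) * (m * d - 2)
  have hq : 0 ≤ q := mul_nonneg (by linarith) (by linarith)
  have hqd : q ≤ d ^ 2 := by simp only [q]; nlinarith
  have hr : 0 < r := mul_pos h1 h2
  have hs : s * r ^ 2 = m * d * q ^ 3 * N := by
    refine mul_right_cancel₀ (pow_ne_zero 2 (show (m * d : ℝ) ≠ 0 by linarith)) ?_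
    simp only [q, r]
    linear_combination h'
  have hs' : s = m * d * q ^ 3 * N / r ^ 2 := by rw [← hs]; field_simp
  rw [hs', div_le_iff₀ (by positivity)]
  have e4 : (m ^ 2 * q) ^ 2 ≤ r ^ 2 := by gcongr
  calc m * d * q ^ 3 * N = m * d * q * N * (m ^ 2 * q) ^ 2 / m ^ 4 := by field_simp
    _ ≤ m * d * d ^ 2 * N * r ^ 2 / m ^ 4 := by gcongr
    _ = _ := by field_simp

theorem sum_card_coincidentQuads_le (hv : ∀ x, #{z | v z = v x} = d)
    (hα : Fintype.card α = m * d) (hd : 2 ≤ d) (hm : 2 ≤ m) :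
    ∑ σ : Equiv.Perm α × Equiv.Perm α,
        (#(coincidentQuads fun i => (v i, v (σ.1 i), v (σ.2 i))) : ℝ)
      ≤ (1 + 12 / (m * d - 3)) * ((m * d) * (d - 1) ^ 3 / (m * d - 1) ^ 2 : ℝ) ^ 2 *
        ((m * d).factorial : ℝ) ^ 2 := by
  have h := sum_card_coincidentQuads v
  have hT := Nat.pow_le_pow_left (card_coincidentQuads_le hv) 3
  have h := h.le.trans (Nat.mul_le_mul_right _ hT)
  rw [card_coincidentQuads_const, hα] at h
  have hn : 4 ≤ m * d := Nat.mul_le_mul hm hd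
  have hnR : (4 : ℝ) ≤ m * d := by exact_mod_cast hn
  have hdR : (2 : ℝ) ≤ d := by exact_mod_cast hd
  have h' := Nat.cast_le (α := ℝ).2 h
  push_cast [Nat.cast_sub (show 1 ≤ d by omega), Nat.cast_sub (show 1 ≤ m * d by omega),
    Nat.cast_sub (show 2 ≤ m * d by omega), Nat.cast_sub (show 3 ≤ m * d by omega)] at h'
  set N := ((m * d).factorial : ℝ) ^ 2
  set s := ∑ σ : Equiv.Perm α × Equiv.Perm α,
        (#(coincidentQuads fun i => (v i, v (σ.1 i), v (σ.2 i))) : ℝ)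
  set n : ℝ := m * d
  have hN : 0 ≤ N := by positivity
  have h0 : 0 < n := by linarith
  have h1 : 0 < n - 1 := by linarith
  have h2 : 0 < n - 2 := by linarith
  have h3 : 0 < n - 3 := by linarith
  have hd1 : (0 : ℝ) ≤ d - 1 := by linarith
  have hs : s ≤ (n * (d - 1) * (n - 2) * (d - 1)) ^ 3 * N /
      (n * (n - 1) * (n - 2) * (n - 3)) ^ 2 := by
    rw [le_div_iff₀ (by positivity)]
    exact h'
  refine hs.trans ?_
  have hfrac : (n - 2) / (n - 3) ^ 2 ≤ (1 + 12 / (n - 3)) * n / (n - 1) ^ 2 := by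
    rw [div_le_div_iff₀ (by positivity) (by positivity)]
    have : (1 + 12 / (n - 3)) * n * (n - 3) ^ 2 = (n + 9) * n * (n - 3) := by
      field_simp
      ring
    rw [this]
    nlinarith
  calc (n * (d - 1) * (n - 2) * (d - 1)) ^ 3 * N / (n * (n - 1) * (n - 2) * (n - 3)) ^ 2
      = (n - 2) / (n - 3) ^ 2 * (n * (d - 1) ^ 6 * N / (n - 1) ^ 2) := by field_simp
    _ ≤ (1 + 12 / (n - 3)) * n / (n - 1) ^ 2 * (n * (d - 1) ^ 6 * N / (n - 1) ^ 2) := by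
      gcongr
    _ = _ := by field_simp

/-- Markov's inequality for coincident triples. -/
theorem card_coincidentTriples_nonempty_le (hv : ∀ x, #{z | v z = v x} = d)
    (hα : Fintype.card α = m * d) (hd : 2 ≤ d) (hm : 2 ≤ m) :
    (#{σ : Equiv.Perm α × Equiv.Perm α |
        (coincidentTriples fun i => (v i, v (σ.1 i), v (σ.2 i))).Nonempty} : ℝ)
      ≤ ((d : ℝ) / m) ^ 3 * ((m * d).factorial : ℝ) ^ 2 := by
  refine le_trans ?_ (sum_card_coincidentTriples_le hv hα hd hm)
  rw [card_filter]
  push_cast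
  refine sum_le_sum fun σ _ => ?_
  split_ifs with h
  · exact_mod_cast h.card_pos
  · positivity

/-- Chebyshev's inequality for coincident pairs. -/
theorem card_coincidentPairs_large_le (hv : ∀ x, #{z | v z = v x} = d)
    (hα : Fintype.card α = m * d) (hd : 2 ≤ d) (hm : 2 ≤ m) {L : ℝ} (hL : 0 < L) :
    (#{σ : Equiv.Perm α × Equiv.Perm α | 2 * (8 * (d : ℝ) ^ 2 / m + L) ≤
        #(coincidentPairs fun i => (v i, v (σ.1 i), v (σ.2 i)))} : ℝ)
      ≤ (L⁻¹ + (d / m) ^ 3 * L⁻¹ ^ 2 + 12 / (m * d - 3)) * ((m * d).factorial : ℝ) ^ 2 := by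
  have hnR : (4 : ℝ) ≤ m * d := by exact_mod_cast Nat.mul_le_mul hm hd
  have hmR : (2 : ℝ) ≤ m := by exact_mod_cast hm
  have hdR : (2 : ℝ) ≤ d := by exact_mod_cast hd
  have hY := sum_card_coincidentPairs_eq hv hα hd hm
  have hT := sum_card_coincidentTriples_le hv hα hd hm
  have hQ := sum_card_coincidentQuads_le hv hα hd hm
  set N := ((m * d).factorial : ℝ) ^ 2
  set Y : Equiv.Perm α × Equiv.Perm α → ℝ :=
    fun σ => #(coincidentPairs fun i => (v i, v (σ.1 i), v (σ.2 i))) with hYdef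
  have hN : 0 ≤ N := by positivity
  set c : ℝ := (d / m) ^ 3
  have hc : 0 ≤ c := by positivity
  set a : ℝ := (m * d) * (d - 1) ^ 3 / (m * d - 1) ^ 2 with ha
  set s : ℝ := (d : ℝ) ^ 2 / m with hs
  set ε : ℝ := 12 / (m * d - 3)
  have hε : 0 ≤ ε := div_nonneg (by norm_num) (by linarith)
  have hs0 : 0 < s := by positivity
  have ha0 : 0 ≤ a := by
    have : (0 : ℝ) ≤ d - 1 := by linarith
    positivity
  have has : a ≤ s := by
    have h1 : (0 : ℝ) < m * d - 1 := by linarith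
    have hd1 : (0 : ℝ) ≤ d - 1 := by linarith
    rw [ha, hs, div_le_div_iff₀ (by positivity) (by positivity)]
    have e1 : (m * ((d : ℝ) - 1)) ^ 2 ≤ (m * d - 1) ^ 2 := by
      gcongr
      linarith
    calc (m : ℝ) * d * (d - 1) ^ 3 * (m : ℝ)
        = (d : ℝ) * (d - 1) * (m * ((d : ℝ) - 1)) ^ 2 := by ring
      _ ≤ (d : ℝ) * d * (m * d - 1) ^ 2 := by gcongr; linarith
      _ = _ := by ring
  have hY2 : ∑ σ, Y σ ^ 2 ≤ (2 * a + 4 * c + (1 + ε) * a ^ 2) * N := by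
    calc ∑ σ, Y σ ^ 2
        ≤ ∑ σ : Equiv.Perm α × Equiv.Perm α, (2 * Y σ
          + 4 * (#(coincidentTriples fun i => (v i, v (σ.1 i), v (σ.2 i))) : ℝ)
          + #(coincidentQuads fun i => (v i, v (σ.1 i), v (σ.2 i)))) :=
        sum_le_sum fun σ _ => by simp only [hYdef]; exact_mod_cast sq_card_coincidentPairs_le _
      _ ≤ _ := by
        rw [sum_add_distrib, sum_add_distrib, ← mul_sum, ← mul_sum]
        linarith
  have hcardN : ((Fintype.card (Equiv.Perm α × Equiv.Perm α) : ℕ) : ℝ) = N := by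
    rw [Fintype.card_prod, Fintype.card_perm, hα]
    push_cast
    ring
  have hvar : ∑ σ, (Y σ - a) ^ 2 ≤ (2 * a + 4 * c + ε * a ^ 2) * N := by
    have : ∑ σ, (Y σ - a) ^ 2 = ∑ σ, Y σ ^ 2 - 2 * a * ∑ σ, Y σ + a ^ 2 * N := by
      rw [← hcardN, mul_sum, ← sum_sub_distrib, mul_comm (a ^ 2), ← nsmul_eq_mul, ← card_univ,
        ← sum_const, ← sum_add_distrib]
      exact sum_congr rfl fun σ _ => by ring
    rw [this, hY]
    linarith
  set B : Finset (Equiv.Perm α × Equiv.Perm α) := {σ | 2 * (8 * (d : ℝ) ^ 2 / m + L) ≤ Y σ}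
    with hB
  have hcheb : (#B : ℝ) * (15 * s + 2 * L) ^ 2 ≤ (2 * a + 4 * c + ε * a ^ 2) * N := by
    refine le_trans ?_ hvar
    rw [← nsmul_eq_mul, ← sum_const]
    refine (sum_le_sum fun σ hσ => ?_).trans
      (sum_le_sum_of_subset_of_nonneg (subset_univ B) fun σ _ _ => sq_nonneg _)
    have hσ' := (mem_filter.1 hσ).2
    rw [mul_div_assoc, ← hs] at hσ'
    gcongr
    linarith
  have hbound : 2 * a + 4 * c + ε * a ^ 2 ≤
      (L⁻¹ + c * L⁻¹ ^ 2 + ε) * (15 * s + 2 * L) ^ 2 := by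
    have e1 : 2 * a ≤ L⁻¹ * (15 * s + 2 * L) ^ 2 := by
      rw [inv_mul_eq_div, le_div_iff₀ hL]
      nlinarith
    have e2 : 4 * c ≤ c * L⁻¹ ^ 2 * (15 * s + 2 * L) ^ 2 := by
      have : (2 * L) ^ 2 ≤ (15 * s + 2 * L) ^ 2 := by gcongr; linarith
      calc 4 * c = c * L⁻¹ ^ 2 * (2 * L) ^ 2 := by
            field_simp
            ring
        _ ≤ _ := by gcongr
    have e3 : ε * a ^ 2 ≤ ε * (15 * s + 2 * L) ^ 2 := by
      gcongr
      linarith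
    linarith
  refine le_of_mul_le_mul_right ?_ (show 0 < (15 * s + 2 * L) ^ 2 by positivity)
  refine hcheb.trans ((mul_le_mul_of_nonneg_right hbound hN).trans_eq ?_)
  ring

end RandomPermutations

section ConfigurationModel

theorem card_vmap_fiber {m d : ℕ} (a : Fin m) : #{s : Fin (m * d) | vmap s = a} = d := by
  conv_rhs => rw [← Fintype.card_fin d, ← card_univ,
    ← card_map ((Function.Embedding.sectR a (Fin d)).trans finProdFinEquiv.toEmbedding)]
  congr 1
  ext s
  obtain ⟨⟨b, t⟩, rfl⟩ := finProdFinEquiv.surjective s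
  have hb : vmap (finProdFinEquiv (b, t)) = b := by
    have : (t : ℕ) / d = 0 := Nat.div_eq_of_lt t.2
    ext
    simp [vmap, Nat.add_mul_div_left _ _ t.pos, this]
  simp [hb, eq_comm]

/-- Each unordered coincident pair is counted twice among the ordered ones. -/
theorem two_mul_card_lt_le {α β : Type*} [Fintype α] [LinearOrder α] [DecidableEq β]
    (e : α → β) :
    2 * #{p : α × α | p.1 < p.2 ∧ e p.1 = e p.2} ≤ #(coincidentPairs e) := by
  set A : Finset (α × α) := {p | p.1 < p.2 ∧ e p.1 = e p.2} with hA
  have hdisj : Disjoint A (A.map (Equiv.prodComm α α).toEmbedding) := by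
    rw [disjoint_left]
    rintro ⟨i, j⟩ h h'
    simp only [hA, mem_map_equiv, mem_filter, mem_univ, true_and] at h h'
    exact lt_asymm h.1 h'.1
  rw [two_mul]
  nth_rewrite 2 [← card_map (Equiv.prodComm α α).toEmbedding]
  rw [← card_union_of_disjoint hdisj]
  refine card_le_card ?_
  rintro ⟨i, j⟩ h
  simp only [hA, mem_union, mem_map_equiv, mem_filter, mem_univ, true_and] at h
  simp only [coincidentPairs, mem_filter, mem_univ, true_and]
  rcases h with h | h
  · exact ⟨h.1.ne, h.2.symm⟩
  · exact ⟨h.1.ne', h.2⟩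

/-- A configuration without three coincident edges and with at most `M` coincident pairs. -/
def HasFewMultipleEdges {m d : ℕ}
    (σ : Equiv.Perm (Fin (m * d)) × Equiv.Perm (Fin (m * d))) : Prop :=
  (¬ ∃ i j k : Fin (m * d), i ≠ j ∧ i ≠ k ∧ j ≠ k ∧
    edge3 σ i = edge3 σ j ∧ edge3 σ j = edge3 σ k) ∧
  #{p : Fin (m * d) × Fin (m * d) | p.1 < p.2 ∧ edge3 σ p.1 = edge3 σ p.2} ≤ Mbound m d

theorem hasFewMultipleEdges_or {m d : ℕ}
    (σ : Equiv.Perm (Fin (m * d)) × Equiv.Perm (Fin (m * d))) :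
    HasFewMultipleEdges σ ∨ (coincidentTriples (edge3 σ)).Nonempty ∨
      2 * (8 * (d : ℝ) ^ 2 / m + Real.log m) ≤ #(coincidentPairs (edge3 σ)) := by
  by_contra! ⟨hgood, hT, hP⟩
  refine hgood ⟨?_, ?_⟩
  · rintro ⟨i, j, k, hij, hik, hjk, h1, h2⟩
    have : ((i, j), k) ∈ coincidentTriples (edge3 σ) := by
      simp only [coincidentTriples, coincidentPairs, mem_filter, mem_univ, true_and]
      exact ⟨⟨hij, h1.symm⟩, hik.symm, hjk.symm, (h1.trans h2).symm⟩
    simp [hT] at this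
  · refine Nat.le_floor ?_
    have h := Nat.cast_le (α := ℝ).2 (two_mul_card_lt_le (edge3 σ))
    push_cast at h
    linarith

theorem card_hasFewMultipleEdges_ge {m d : ℕ} (hm : 2 ≤ m) (hd : 2 ≤ d) :
    1 - (((d : ℝ) / m) ^ 3 + ((Real.log m)⁻¹ + ((d : ℝ) / m) ^ 3 * (Real.log m)⁻¹ ^ 2
        + 12 / (m * d - 3)))
      ≤ (Nat.card {σ : Equiv.Perm (Fin (m * d)) × Equiv.Perm (Fin (m * d)) //
          HasFewMultipleEdges σ} : ℝ) / ((m * d).factorial : ℝ) ^ 2 := by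
  classical
  have hL : 0 < Real.log m := Real.log_pos (by exact_mod_cast hm)
  have hv : ∀ x : Fin (m * d), #{z | vmap z = vmap x} = d := fun x => card_vmap_fiber _
  have hA := card_coincidentTriples_nonempty_le hv (Fintype.card_fin _) hd hm
  have hB := card_coincidentPairs_large_le hv (Fintype.card_fin _) hd hm hL
  rw [le_div_iff₀ (by positivity), Nat.card_eq_fintype_card, Fintype.card_subtype]
  set A : Finset (Equiv.Perm (Fin (m * d)) × Equiv.Perm (Fin (m * d))) :=
    {σ | (coincidentTriples (edge3 σ)).Nonempty}
  set B : Finset (Equiv.Perm (Fin (m * d)) × Equiv.Perm (Fin (m * d))) :=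
    {σ | 2 * (8 * (d : ℝ) ^ 2 / m + Real.log m) ≤ #(coincidentPairs (edge3 σ))}
  set C : Finset (Equiv.Perm (Fin (m * d)) × Equiv.Perm (Fin (m * d))) :=
    {σ | HasFewMultipleEdges σ}
  have hcover : (univ : Finset (Equiv.Perm (Fin (m * d)) × Equiv.Perm (Fin (m * d)))) ⊆
      C ∪ (A ∪ B) := by
    intro σ _
    simpa [A, B, C] using hasFewMultipleEdges_or σ
  have hcard : (m * d).factorial ^ 2 ≤ #C + (#A + #B) := by
    calc (m * d).factorial ^ 2
        = #(univ : Finset (Equiv.Perm (Fin (m * d)) × Equiv.Perm (Fin (m * d)))) := by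
          rw [card_univ, Fintype.card_prod, Fintype.card_perm, Fintype.card_fin, sq]
      _ ≤ _ := (card_le_card hcover).trans <| (card_union_le _ _).trans <|
          Nat.add_le_add_left (card_union_le _ _) _
  have hcardR : ((m * d).factorial : ℝ) ^ 2 ≤ #C + (#A + #B) := by exact_mod_cast hcard
  have hA' : (#A : ℝ) ≤ _ := hA
  have hB' : (#B : ℝ) ≤ _ := hB
  linarith

theorem card_hasFewMultipleEdges_le (m d : ℕ) :
    (Nat.card {σ : Equiv.Perm (Fin (m * d)) × Equiv.Perm (Fin (m * d)) //
      HasFewMultipleEdges σ} : ℝ) / ((m * d).factorial : ℝ) ^ 2 ≤ 1 := by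
  refine div_le_one_of_le₀ ?_ (by positivity)
  have h := Finite.card_subtype_le
    (fun σ : Equiv.Perm (Fin (m * d)) × Equiv.Perm (Fin (m * d)) => HasFewMultipleEdges σ)
  rw [Nat.card_prod, Nat.card_perm, Nat.card_fin, ← sq] at h
  exact_mod_cast h

theorem tendsto_error_bound {d : ℕ → ℕ} (hd : ∀ m, 2 ≤ d m)
    (hdo : (fun m => (d m : ℝ)) =o[atTop] (fun m => (m : ℝ))) :
    Tendsto (fun m : ℕ => 1 - (((d m : ℝ) / m) ^ 3 + ((Real.log m)⁻¹
      + ((d m : ℝ) / m) ^ 3 * (Real.log m)⁻¹ ^ 2 + 12 / (m * d m - 3)))) atTop (nhds 1) := by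
  have h1 : Tendsto (fun m : ℕ => ((d m : ℝ) / m) ^ 3) atTop (nhds 0) := by
    simpa using hdo.tendsto_div_nhds_zero.pow 3
  have h2 : Tendsto (fun m : ℕ => (Real.log m)⁻¹) atTop (nhds 0) :=
    (Real.tendsto_log_atTop.comp tendsto_natCast_atTop_atTop).inv_tendsto_atTop
  have h3 : Tendsto (fun m : ℕ => (12 : ℝ) / (m * d m - 3)) atTop (nhds 0) := by
    refine Tendsto.const_div_atTop (tendsto_atTop_add_const_right _ _ ?_) _
    refine tendsto_atTop_mono (fun m => ?_) tendsto_natCast_atTop_atTop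
    exact le_mul_of_one_le_right m.cast_nonneg (by exact_mod_cast one_le_two.trans (hd m))
  simpa using (h1.add ((h2.add (h1.mul (h2.pow 2))).add h3)).const_sub 1

end ConfigurationModel

end MultipleEdges

/-- for `r = 3`, `m → ∞`, `2 ≤ d = o(m)`, with probability `1 − o(1)` a
uniformly random configuration `(σ₂, σ₃)` has (a) no three distinct indices with pairwise
equal edges, and (b) at most `M` unordered pairs of distinct indices with equal edges. -/
theorem configuration_model_few_multiple_edges
    (d : ℕ → ℕ) (hd : ∀ m, 2 ≤ d m)
    (hdo : (fun m => (d m : ℝ)) =o[atTop] (fun m => (m : ℝ))) :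
    Tendsto (fun m =>
      (Nat.card {σ : Equiv.Perm (Fin (m * d m)) × Equiv.Perm (Fin (m * d m)) //
          (¬ ∃ i j k : Fin (m * d m), i ≠ j ∧ i ≠ k ∧ j ≠ k ∧
            edge3 σ i = edge3 σ j ∧ edge3 σ j = edge3 σ k) ∧
          (Finset.univ.filter (fun p : Fin (m * d m) × Fin (m * d m) =>
            p.1 < p.2 ∧ edge3 σ p.1 = edge3 σ p.2)).card ≤ Mbound m (d m)} : ℝ) /
        ((m * d m).factorial : ℝ) ^ 2) atTop (nhds 1) := by
  refine tendsto_of_tendsto_of_tendsto_of_le_of_le' (MultipleEdges.tendsto_error_bound hd hdo)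
    tendsto_const_nhds ?_ (Eventually.of_forall fun m =>
      MultipleEdges.card_hasFewMultipleEdges_le m (d m))
  filter_upwards [eventually_ge_atTop 2] with m hm
  exact MultipleEdges.card_hasFewMultipleEdges_ge hm (hd m)
end

section
/- Let r = 3, let m → ∞ and let d = d(m) be integers with 2 ≤ d and d = o(m). Then P_3(d,m) = (1+o(1))·exp(−d²/(2m)), where P_3(d,m) is the proportion of pairs (σ₂, σ₃) of permutations of Fin(md) for which the edge map i ↦ (v(i), v(σ₂(i)), v(σ₃(i))) is injective. -/
open Filter Asymptotics

/-- `P_3(d,m)`: the fraction of the `((m·d)!)²` configuration pairs `(σ₂, σ₃)` whose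
edge map is injective. -/
noncomputable def P3 (m d : ℕ) : ℝ :=
  (Nat.card {σ : Equiv.Perm (Fin (m * d)) × Equiv.Perm (Fin (m * d)) //
      Function.Injective (edge3 σ)} : ℝ) / ((m * d).factorial : ℝ) ^ 2

namespace ConfigurationModel

open Finset Equiv

section Switching

variable {P V : Type*}

/-- The edge at position `p` of the configuration `σ`, for a general vertex map `v`. -/
def edge (v : P → V) (σ : Perm P × Perm P) (p : P) : V × V × V :=
  (v p, v (σ.1 p), v (σ.2 p))

/-- The positions `j`, `f`, `g` have pairwise different first endpoints. -/
def Separated (v : P → V) (j f g : P) : Prop :=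
  v j ≠ v f ∧ v j ≠ v g ∧ v f ≠ v g

/-- Switching at `j`, `f`, `g` makes one of these edges equal to an edge at another position. -/
def Blocked (v : P → V) (σ : Perm P × Perm P) (j f g : P) : Prop :=
  ∃ h, h ≠ j ∧ h ≠ f ∧ h ≠ g ∧ (edge v σ h = (v j, v (σ.1 f), v (σ.2 g)) ∨
    edge v σ h = (v f, v (σ.1 g), v (σ.2 j)) ∨ edge v σ h = (v g, v (σ.1 j), v (σ.2 f)))

variable {v : P → V} {σ : Perm P × Perm P} {i j f g p : P}

lemma Separated.ne (h : Separated v j f g) : j ≠ f ∧ j ≠ g ∧ f ≠ g :=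
  ⟨fun e => h.1 (congrArg v e), fun e => h.2.1 (congrArg v e), fun e => h.2.2 (congrArg v e)⟩

variable [DecidableEq P]

/-- The switching that cyclically permutes the second endpoints of the edges at positions
`j`, `f`, `g`, and their third endpoints in the opposite direction. -/
def rotate (j f g : P) : Perm (Perm P × Perm P) :=
  Equiv.mulRight (swap j f * swap f g, swap f g * swap j f)

lemma rotate_apply_fst : (rotate j f g σ).1 p = σ.1 (swap j f (swap f g p)) := rfl

lemma rotate_apply_snd : (rotate j f g σ).2 p = σ.2 (swap f g (swap j f p)) := rfl

lemma edge_rotate_of_ne (hj : p ≠ j) (hf : p ≠ f) (hg : p ≠ g) :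
    edge v (rotate j f g σ) p = edge v σ p := by
  simp [edge, rotate_apply_fst, rotate_apply_snd, swap_apply_of_ne_of_ne, *]

lemma edge_rotate_fst (h : Separated v j f g) :
    edge v (rotate j f g σ) j = (v j, v (σ.1 f), v (σ.2 g)) := by
  obtain ⟨h1, h2, h3⟩ := h.ne
  simp [edge, rotate_apply_fst, rotate_apply_snd, swap_apply_of_ne_of_ne, *]

lemma edge_rotate_snd (h : Separated v j f g) :
    edge v (rotate j f g σ) f = (v f, v (σ.1 g), v (σ.2 j)) := by
  obtain ⟨h1, h2, h3⟩ := h.ne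
  simp [edge, rotate_apply_fst, rotate_apply_snd, swap_apply_of_ne_of_ne, h1, h2, h2.symm, h3.symm]

lemma edge_rotate_thd (h : Separated v j f g) :
    edge v (rotate j f g σ) g = (v g, v (σ.1 j), v (σ.2 f)) := by
  obtain ⟨h1, h2, h3⟩ := h.ne
  simp [edge, rotate_apply_fst, rotate_apply_snd, swap_apply_of_ne_of_ne, h2.symm, h3.symm]

variable [Fintype P] [DecidableEq V]

/-- The ordered pairs of distinct positions carrying the same edge. -/
def coincidences (v : P → V) (σ : Perm P × Perm P) : Finset (P × P) :=
  univ.filter fun x => x.1 ≠ x.2 ∧ edge v σ x.1 = edge v σ x.2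

lemma mem_coincidences {x : P × P} :
    x ∈ coincidences v σ ↔ x.1 ≠ x.2 ∧ edge v σ x.1 = edge v σ x.2 := by
  simp [coincidences]

/-- A coincidence present after a switching was either present before, away from the switched
positions, or joins a switched position to another one. -/
lemma mem_coincidences_rotate (h : Separated v j f g) {x : P × P}
    (hx : x ∈ coincidences v (rotate j f g σ)) :
    (x ∈ coincidences v σ ∧ x.1 ≠ j ∧ x.2 ≠ j) ∨
    ∃ k l, k ≠ j ∧ k ≠ f ∧ k ≠ g ∧ (x = (k, l) ∨ x = (l, k)) ∧
      (l = j ∧ edge v σ k = (v j, v (σ.1 f), v (σ.2 g)) ∨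
       l = f ∧ edge v σ k = (v f, v (σ.1 g), v (σ.2 j)) ∨
       l = g ∧ edge v σ k = (v g, v (σ.1 j), v (σ.2 f))) := by
  obtain ⟨p, q⟩ := x
  rw [mem_coincidences] at hx
  obtain ⟨hne, he⟩ := hx
  simp only at hne he
  have hv : v p = v q := congrArg Prod.fst he
  obtain ⟨s1, s2, s3⟩ := h
  have h : Separated v j f g := ⟨s1, s2, s3⟩
  have key : ∀ p q : P, v p = v q → p ≠ q → (p = j ∨ p = f ∨ p = g) →
      q ≠ j ∧ q ≠ f ∧ q ≠ g := by
    rintro p q hv hne (rfl | rfl | rfl) <;> refine ⟨?_, ?_, ?_⟩ <;> rintro rfl <;> simp_all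
  have key2 : ∀ p q : P, edge v (rotate j f g σ) p = edge v (rotate j f g σ) q →
      (q ≠ j ∧ q ≠ f ∧ q ≠ g) → (p = j ∨ p = f ∨ p = g) →
      (p = j ∧ edge v σ q = (v j, v (σ.1 f), v (σ.2 g)) ∨
       p = f ∧ edge v σ q = (v f, v (σ.1 g), v (σ.2 j)) ∨
       p = g ∧ edge v σ q = (v g, v (σ.1 j), v (σ.2 f))) := by
    rintro p q he ⟨q1, q2, q3⟩ hp
    rw [edge_rotate_of_ne q1 q2 q3] at he
    rcases hp with rfl | rfl | rfl
    · rw [edge_rotate_fst h] at he; exact Or.inl ⟨rfl, he.symm⟩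
    · rw [edge_rotate_snd h] at he; exact Or.inr (Or.inl ⟨rfl, he.symm⟩)
    · rw [edge_rotate_thd h] at he; exact Or.inr (Or.inr ⟨rfl, he.symm⟩)
  by_cases hp : p = j ∨ p = f ∨ p = g
  · have hq := key p q hv hne hp
    exact Or.inr ⟨q, p, hq.1, hq.2.1, hq.2.2, Or.inr rfl, key2 p q he hq hp⟩
  by_cases hq : q = j ∨ q = f ∨ q = g
  · have hp := key q p hv.symm hne.symm hq
    exact Or.inr ⟨p, q, hp.1, hp.2.1, hp.2.2, Or.inl rfl, key2 q p he.symm hp hq⟩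
  push Not at hp hq
  refine Or.inl ⟨?_, hp.1, hq.1⟩
  rw [edge_rotate_of_ne hp.1 hp.2.1 hp.2.2, edge_rotate_of_ne hq.1 hq.2.1 hq.2.2] at he
  exact mem_coincidences.2 ⟨hne, he⟩

lemma mem_coincidences_of_not_blocked (h : Separated v j f g) (hb : ¬ Blocked v σ j f g)
    {x : P × P} (hx : x ∈ coincidences v (rotate j f g σ)) :
    x ∈ coincidences v σ ∧ x.1 ≠ j ∧ x.2 ≠ j := by
  rcases mem_coincidences_rotate h hx with h' | ⟨k, l, h1, h2, h3, -, h4⟩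
  · exact h'
  · exact absurd ⟨k, h1, h2, h3, by tauto⟩ hb

/-- The weight `t ^ (number of coincidences)` of a configuration. -/
noncomputable def weight (v : P → V) (t : ℝ) (σ : Perm P × Perm P) : ℝ :=
  t ^ (coincidences v σ).card

variable {t : ℝ}

lemma weight_nonneg (ht : 0 ≤ t) : 0 ≤ weight v t σ := pow_nonneg ht _

lemma weight_le_weight_rotate (ht : 0 ≤ t) (ht1 : t ≤ 1) (h : Separated v j f g)
    (hb : ¬ Blocked v σ j f g) : weight v t σ ≤ weight v t (rotate j f g σ) :=
  pow_le_pow_of_le_one ht ht1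
    (card_le_card fun _ hx => (mem_coincidences_of_not_blocked h hb hx).1)

lemma weight_le_sq_mul_weight_rotate (ht : 0 ≤ t) (ht1 : t ≤ 1) (h : Separated v j f g)
    (hb : ¬ Blocked v σ j f g) (hij : i ≠ j) (he : edge v σ i = edge v σ j) :
    weight v t σ ≤ t ^ 2 * weight v t (rotate j f g σ) := by
  rw [weight, weight, ← pow_add]
  refine pow_le_pow_of_le_one ht ht1 ?_
  have hdisj : Disjoint ({(i, j), (j, i)} : Finset (P × P))
      (coincidences v (rotate j f g σ)) := by
    rw [Finset.disjoint_left]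
    intro x hx hx'
    have := mem_coincidences_of_not_blocked h hb hx'
    simp only [mem_insert, mem_singleton] at hx
    rcases hx with rfl | rfl <;> simp at this
  have hcard : ({(i, j), (j, i)} : Finset (P × P)).card = 2 :=
    card_pair (by simp [hij])
  rw [← hcard, ← card_union_of_disjoint hdisj]
  refine card_le_card (union_subset ?_ fun _ hx => (mem_coincidences_of_not_blocked h hb hx).1)
  intro x hx
  simp only [mem_insert, mem_singleton] at hx
  rcases hx with rfl | rfl
  · exact mem_coincidences.2 ⟨hij, he⟩
  · exact mem_coincidences.2 ⟨hij.symm, he.symm⟩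

lemma sq_mul_weight_le_weight_rotate (ht : 0 ≤ t) (ht1 : t ≤ 1) (h : Separated v j f g)
    (hb : ∀ k, k ≠ j → k ≠ f → k ≠ g →
      (k ≠ i → edge v σ k ≠ (v j, v (σ.1 f), v (σ.2 g))) ∧
      edge v σ k ≠ (v f, v (σ.1 g), v (σ.2 j)) ∧ edge v σ k ≠ (v g, v (σ.1 j), v (σ.2 f))) :
    t ^ 2 * weight v t σ ≤ weight v t (rotate j f g σ) := by
  rw [weight, weight, ← pow_add]
  refine pow_le_pow_of_le_one ht ht1 ?_
  have hsub : coincidences v (rotate j f g σ) ⊆ {(i, j), (j, i)} ∪ coincidences v σ := by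
    intro x hx
    rcases mem_coincidences_rotate h hx with h' | ⟨k, l, h1, h2, h3, h4, h5⟩
    · exact mem_union_right _ h'.1
    · obtain ⟨c1, c2, c3⟩ := hb k h1 h2 h3
      rcases h5 with ⟨rfl, h5⟩ | ⟨-, h5⟩ | ⟨-, h5⟩
      · by_cases hk : k = i
        · subst hk
          exact mem_union_left _ (by simpa using h4)
        · exact absurd h5 (c1 hk)
      · exact absurd h5 c2
      · exact absurd h5 c3
  exact (card_le_card hsub).trans
    ((card_union_le _ _).trans (Nat.add_le_add_right card_le_two _))

end Switching

section Counting

variable {P V : Type*} [Fintype P] [DecidableEq V] {v : P → V} {d : ℕ}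

lemma card_filter_perm (hv : ∀ a, #{p | v p = a} = d) (τ : Perm P) (a : V) :
    #{p | v (τ p) = a} = d := by
  rw [← hv a]
  exact card_equiv τ (by simp)

lemma card_eq_mul [Fintype V] (hv : ∀ a, #{p | v p = a} = d) :
    Fintype.card P = Fintype.card V * d := by
  rw [← card_univ, card_eq_sum_card_fiberwise (f := v) (t := univ) (by simp)]
  simp [hv]

lemma sum_comp_perm [Fintype V] (hv : ∀ a, #{p | v p = a} = d) (τ : Perm P) (F : V → ℝ) :
    ∑ p, F (v (τ p)) = d * ∑ a, F a := by
  rw [← Finset.sum_fiberwise (s := univ) (g := fun p => v (τ p)), mul_sum]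
  refine sum_congr rfl fun a _ => ?_
  rw [sum_congr rfl (g := fun _ => F a) (by simp +contextual), sum_const,
    card_filter_perm hv τ a, nsmul_eq_mul]

variable [DecidableEq P]

lemma card_filter_eq (hv : ∀ a, #{p | v p = a} = d) :
    #{x : P × P | v x.1 = v x.2} = Fintype.card P * d := by
  have : ({x : P × P | v x.1 = v x.2} : Finset (P × P)) =
      univ.biUnion fun p => {p} ×ˢ ({q | v q = v p} : Finset P) := by
    ext ⟨p, q⟩
    simp [eq_comm]
  rw [this, card_biUnion]
  · simp [hv]
  · intro p _ q _ hpq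
    rw [Function.onFun, Finset.disjoint_left]
    rintro ⟨a, b⟩ h1 h2
    simp only [mem_product, mem_singleton] at h1 h2
    exact hpq (h1.1.symm.trans h2.1)

lemma card_not_separated_le (hv : ∀ a, #{p | v p = a} = d) (j : P) :
    #{x : P × P | v j = v x.1 ∨ v j = v x.2 ∨ v x.1 = v x.2} ≤ 3 * (Fintype.card P * d) := by
  have hsub : ({x : P × P | v j = v x.1 ∨ v j = v x.2 ∨ v x.1 = v x.2} : Finset (P × P)) ⊆
      ({p | v p = v j} : Finset P) ×ˢ univ ∪ (univ ×ˢ ({p | v p = v j} : Finset P) ∪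
        ({x : P × P | v x.1 = v x.2} : Finset (P × P))) := by
    intro x
    simp only [mem_filter, mem_univ, true_and, mem_union, mem_product, and_true]
    tauto
  refine (card_le_card hsub).trans ((card_union_le _ _).trans
    (Nat.add_le_add_left (card_union_le _ _) _ |>.trans ?_))
  rw [card_product, card_product, hv, card_filter_eq hv, card_univ]
  lia

lemma card_blocked_le (hv : ∀ a, #{p | v p = a} = d) (σ : Perm P × Perm P) (j : P)
    [DecidablePred fun x : P × P => Blocked v σ j x.1 x.2] :
    #{x : P × P | Blocked v σ j x.1 x.2} ≤ 3 * d ^ 3 := by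
  have h1 := card_filter_perm hv σ.1
  have h2 := card_filter_perm hv σ.2
  have hsub : ({x : P × P | Blocked v σ j x.1 x.2} : Finset (P × P)) ⊆
      (({h | v h = v j} : Finset P).biUnion fun h =>
        ({p | v (σ.1 p) = v (σ.1 h)} : Finset P) ×ˢ ({p | v (σ.2 p) = v (σ.2 h)} : Finset P)) ∪
      ((({h | v (σ.2 h) = v (σ.2 j)} : Finset P).biUnion fun h =>
        ({p | v p = v h} : Finset P) ×ˢ ({p | v (σ.1 p) = v (σ.1 h)} : Finset P)) ∪
      (({h | v (σ.1 h) = v (σ.1 j)} : Finset P).biUnion fun h =>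
        ({p | v (σ.2 p) = v (σ.2 h)} : Finset P) ×ˢ ({p | v p = v h} : Finset P))) := by
    intro x hx
    obtain ⟨h, -, -, -, hx⟩ := (mem_filter.1 hx).2
    simp only [edge, Prod.mk.injEq] at hx
    simp only [mem_filter, mem_univ, true_and, mem_union, mem_biUnion, mem_product]
    rcases hx with ⟨a, b, c⟩ | ⟨a, b, c⟩ | ⟨a, b, c⟩
    · exact Or.inl ⟨h, a, b.symm, c.symm⟩
    · exact Or.inr (Or.inl ⟨h, c, a.symm, b.symm⟩)
    · exact Or.inr (Or.inr ⟨h, b, c.symm, a.symm⟩)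
  refine (card_le_card hsub).trans ((card_union_le _ _).trans
    (Nat.add_le_add_left (card_union_le _ _) _ |>.trans ?_))
  have e : 3 * d ^ 3 = d * (d * d) + (d * (d * d) + d * (d * d)) := by ring
  rw [e]
  refine Nat.add_le_add ?_ (Nat.add_le_add ?_ ?_)
  · rw [← hv (v j)]
    refine card_biUnion_le_card_mul _ _ _ fun h _ => ?_
    rw [card_product, h1, h2, hv]
  · rw [← h2 (v (σ.2 j))]
    refine card_biUnion_le_card_mul _ _ _ fun h _ => ?_
    rw [card_product, h1, h2, hv]
  · rw [← h1 (v (σ.1 j))]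
    refine card_biUnion_le_card_mul _ _ _ fun h _ => ?_
    rw [card_product, h1, h2, hv]

open Classical in
/-- The pairs `(f, g)` that avoid `B` and can be switched with `j` without creating
coincidences. -/
noncomputable def switchable (v : P → V) (σ : Perm P × Perm P) (j : P) (B : Finset P) :
    Finset (P × P) :=
  {x | x.1 ∉ B ∧ x.2 ∉ B ∧ Separated v j x.1 x.2 ∧ ¬ Blocked v σ j x.1 x.2}

lemma le_card_switchable (hv : ∀ a, #{p | v p = a} = d) (σ : Perm P × Perm P) (j : P)
    (B : Finset P) :
    Fintype.card P ^ 2 ≤ #(switchable v σ j B) +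
      (2 * (#B * Fintype.card P) + 3 * (Fintype.card P * d) + 3 * d ^ 3) := by
  classical
  have hsub : (univ : Finset (P × P)) ⊆ switchable v σ j B ∪ ((B ×ˢ univ ∪ univ ×ˢ B) ∪
      ({x : P × P | v j = v x.1 ∨ v j = v x.2 ∨ v x.1 = v x.2} : Finset (P × P)) ∪
      ({x : P × P | Blocked v σ j x.1 x.2} : Finset (P × P))) := by
    intro x _
    simp only [switchable, mem_filter, mem_univ, true_and, mem_union, mem_product, and_true]
    simp only [Separated]
    tauto
  have h := card_le_card hsub
  rw [card_univ, Fintype.card_prod, ← sq] at h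
  have c1 := card_union_le (switchable v σ j B) ((B ×ˢ univ ∪ univ ×ˢ B) ∪
      ({x : P × P | v j = v x.1 ∨ v j = v x.2 ∨ v x.1 = v x.2} : Finset (P × P)) ∪
      ({x : P × P | Blocked v σ j x.1 x.2} : Finset (P × P)))
  have c2 := card_union_le ((B ×ˢ univ ∪ univ ×ˢ B) ∪
      ({x : P × P | v j = v x.1 ∨ v j = v x.2 ∨ v x.1 = v x.2} : Finset (P × P)))
      ({x : P × P | Blocked v σ j x.1 x.2} : Finset (P × P))
  have c3 := card_union_le (B ×ˢ univ ∪ univ ×ˢ B)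
      ({x : P × P | v j = v x.1 ∨ v j = v x.2 ∨ v x.1 = v x.2} : Finset (P × P))
  have c4 := card_union_le (B ×ˢ (univ : Finset P)) (univ ×ˢ B)
  rw [card_product, card_product, card_univ] at c4
  have c5 := card_not_separated_le hv j
  have c6 := card_blocked_le hv σ j
  lia

variable [Fintype V]

/-- Resampling inequality: in the weighted measure, the second and third endpoints at position
`j` behave, up to a constant, as if uniform and independent of the edges at positions in `B`. -/
lemma sum_weight_mul_le (hv : ∀ a, #{p | v p = a} = d) {t κ : ℝ} (ht : 0 ≤ t) (hκ0 : 0 ≤ κ)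
    {j : P} {B : Finset P} (hj : j ∉ B) {F : Perm P × Perm P → V → V → ℝ}
    (hF0 : ∀ σ b c, 0 ≤ F σ b c)
    (hF : ∀ σ σ', (∀ p ∈ B, edge v σ p = edge v σ' p) → F σ = F σ')
    (hκ : ∀ σ f g, Separated v j f g → ¬ Blocked v σ j f g →
      F σ (v (σ.1 j)) (v (σ.2 j)) ≠ 0 → weight v t σ ≤ κ * weight v t (rotate j f g σ)) :
    ((Fintype.card P : ℝ) ^ 2 -
        (2 * (#B * Fintype.card P) + 3 * (Fintype.card P * d) + 3 * d ^ 3)) *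
      ∑ σ, weight v t σ * F σ (v (σ.1 j)) (v (σ.2 j)) ≤
    κ * d ^ 2 * ∑ σ, weight v t σ * ∑ b, ∑ c, F σ b c := by
  calc _ ≤ ∑ σ, ∑ x ∈ switchable v σ j B, weight v t σ * F σ (v (σ.1 j)) (v (σ.2 j)) := by
        rw [mul_sum]
        refine sum_le_sum fun σ _ => ?_
        rw [sum_const, nsmul_eq_mul]
        refine mul_le_mul_of_nonneg_right ?_ (mul_nonneg (weight_nonneg ht) (hF0 _ _ _))
        have := le_card_switchable hv σ j B
        rw [sub_le_iff_le_add]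
        exact_mod_cast this
    _ ≤ ∑ σ, ∑ x : P × P, κ * (weight v t (rotate j x.1 x.2 σ) *
          F (rotate j x.1 x.2 σ) (v ((rotate j x.1 x.2 σ).1 x.2))
            (v ((rotate j x.1 x.2 σ).2 x.1))) := by
        refine sum_le_sum fun σ _ => ?_
        refine le_trans (sum_le_sum fun x hx => ?_) (sum_le_univ_sum_of_nonneg fun x =>
          mul_nonneg hκ0 (mul_nonneg (weight_nonneg ht) (hF0 _ _ _)))
        simp only [switchable, mem_filter, mem_univ, true_and] at hx
        obtain ⟨hx1, hx2, hs, hb⟩ := hx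
        have e1 := edge_rotate_thd (σ := σ) hs
        have e2 := edge_rotate_snd (σ := σ) hs
        simp only [edge, Prod.mk.injEq] at e1 e2
        have hFσ : F (rotate j x.1 x.2 σ) = F σ := by
          refine hF _ _ fun p hp => edge_rotate_of_ne ?_ ?_ ?_
          all_goals rintro rfl; contradiction
        rw [e1.2.1, e2.2.2, hFσ]
        by_cases h0 : F σ (v (σ.1 j)) (v (σ.2 j)) = 0
        · simp [h0]
        · rw [← mul_assoc]
          exact mul_le_mul_of_nonneg_right (hκ σ _ _ hs hb h0) (hF0 _ _ _)
    _ = ∑ x : P × P, ∑ σ, κ * (weight v t σ * F σ (v (σ.1 x.2)) (v (σ.2 x.1))) := by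
        rw [sum_comm]
        refine sum_congr rfl fun x _ => ?_
        exact Equiv.sum_comp (rotate j x.1 x.2)
          (fun σ => κ * (weight v t σ * F σ (v (σ.1 x.2)) (v (σ.2 x.1))))
    _ = _ := by
        rw [sum_comm, mul_sum]
        refine sum_congr rfl fun σ _ => ?_
        rw [← mul_sum, ← mul_sum, Fintype.sum_prod_type_right]
        have : ∀ y : P, ∑ x : P, F σ (v (σ.1 y)) (v (σ.2 x)) = d * ∑ c, F σ (v (σ.1 y)) c :=
          fun y => sum_comp_perm hv σ.2 _
        simp only [this]
        rw [← mul_sum, sum_comp_perm hv σ.1 fun b => ∑ c, F σ b c]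
        ring

end Counting

section Mass

variable {P V : Type*} [Fintype P] [DecidableEq P] [DecidableEq V]

open Classical in
/-- The total weight of the configurations satisfying `A`. -/
noncomputable def mass (v : P → V) (t : ℝ) (A : Perm P × Perm P → Prop) : ℝ :=
  ∑ σ, weight v t σ * if A σ then 1 else 0

/-- The total weight of all configurations. -/
noncomputable def totalMass (v : P → V) (t : ℝ) : ℝ := ∑ σ, weight v t σ

/-- `G` depends only on the edges at the positions in `B`. -/
def DeterminedBy {α : Type*} (v : P → V) (B : Finset P) (G : Perm P × Perm P → α) : Prop :=
  ∀ σ σ', (∀ p ∈ B, edge v σ p = edge v σ' p) → G σ = G σ'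

variable {v : P → V} {d : ℕ} {t : ℝ}

lemma totalMass_nonneg (ht : 0 ≤ t) : 0 ≤ totalMass v t :=
  sum_nonneg fun _ _ => weight_nonneg ht

lemma mass_eq (A : Perm P × Perm P → Prop) [DecidablePred A] :
    mass v t A = ∑ σ, weight v t σ * if A σ then 1 else 0 := by
  unfold mass
  congr!

lemma mass_true : mass v t (fun _ => True) = totalMass v t := by
  simp [mass, totalMass]

lemma mass_mono (ht : 0 ≤ t) {A A' : Perm P × Perm P → Prop} (h : ∀ σ, A σ → A' σ) :
    mass v t A ≤ mass v t A' := by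
  refine sum_le_sum fun σ _ => mul_le_mul_of_nonneg_left ?_ (weight_nonneg ht)
  by_cases hA : A σ
  · simp [hA, h σ hA]
  · rw [if_neg hA]
    positivity

lemma sum_weight_mul_card {ι : Type*} (s : Finset ι) (A : ι → Perm P × Perm P → Prop)
    [∀ x σ, Decidable (A x σ)] :
    ∑ σ, weight v t σ * (#{x ∈ s | A x σ} : ℝ) = ∑ x ∈ s, mass v t (A x) := by
  simp only [mass_eq]
  rw [sum_comm]
  refine sum_congr rfl fun σ _ => ?_
  rw [card_filter, ← mul_sum]
  push_cast
  rfl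

variable [Fintype V]

lemma sum_weight_mul_le_two_div (hv : ∀ a, #{p | v p = a} = d) (hd : 1 ≤ d)
    (hm : 28 * d ≤ Fintype.card V) (ht : 0 ≤ t) (ht1 : t ≤ 1)
    {j : P} {B : Finset P} (hj : j ∉ B) (hB : #B ≤ 4) {F : Perm P × Perm P → V → V → ℝ}
    (hF0 : ∀ σ b c, 0 ≤ F σ b c) (hF : DeterminedBy v B F) :
    ∑ σ, weight v t σ * F σ (v (σ.1 j)) (v (σ.2 j)) ≤
      2 / (Fintype.card V : ℝ) ^ 2 * ∑ σ, weight v t σ * ∑ b, ∑ c, F σ b c := by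
  have key := sum_weight_mul_le hv ht zero_le_one hj hF0 hF fun σ f g hs hb _ => by
    rw [one_mul]; exact weight_le_weight_rotate ht ht1 hs hb
  rw [card_eq_mul hv] at key
  set S := ∑ σ, weight v t σ * F σ (v (σ.1 j)) (v (σ.2 j))
  have hS : 0 ≤ S := sum_nonneg fun σ _ => mul_nonneg (weight_nonneg ht) (hF0 _ _ _)
  have hd' : (1 : ℝ) ≤ d := by exact_mod_cast hd
  have hm' : 28 * (d : ℝ) ≤ Fintype.card V := by exact_mod_cast hm
  have hB' : (#B : ℝ) ≤ 4 := by exact_mod_cast hB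
  set m : ℝ := (Fintype.card V : ℝ)
  have hm0 : 0 < m := by linarith
  have h1 : (m * d) ^ 2 / 2 ≤
      (m * d) ^ 2 - (2 * (#B * (m * d)) + 3 * (m * d * d) + 3 * d ^ 3) := by
    have a1 : (#B : ℝ) * (m * d) ≤ 4 * (m * d) := by gcongr
    have a2 : m * d * (28 * d) ≤ m * d * m := by gcongr
    have a3 : m * d * (28 * d) * 1 ≤ m * d * m * d := by gcongr
    have a4 : m * d * 1 ≤ m * d * d := by gcongr
    have a5 : (d : ℝ) ^ 2 * (28 * d) ≤ d ^ 2 * m := by gcongr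
    nlinarith
  push_cast at key
  have h2 := (mul_le_mul_of_nonneg_right h1 hS).trans key
  have hpos : 0 < (m * d) ^ 2 / 2 := by positivity
  rw [mul_comm, ← le_div_iff₀ hpos] at h2
  refine h2.trans_eq ?_
  field_simp

lemma mass_and_both_le (hv : ∀ a, #{p | v p = a} = d) (hd : 1 ≤ d)
    (hm : 28 * d ≤ Fintype.card V) (ht : 0 ≤ t) (ht1 : t ≤ 1) {j : P} {B : Finset P}
    (hj : j ∉ B) (hB : #B ≤ 4) {A : Perm P × Perm P → Prop} {X Y : Perm P × Perm P → V}
    (hA : DeterminedBy v B A) (hX : DeterminedBy v B X) (hY : DeterminedBy v B Y) :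
    mass v t (fun σ => A σ ∧ v (σ.1 j) = X σ ∧ v (σ.2 j) = Y σ) ≤
      2 / (Fintype.card V : ℝ) ^ 2 * mass v t A := by
  classical
  have := sum_weight_mul_le_two_div hv hd hm ht ht1 hj hB
    (F := fun σ b c => if A σ ∧ b = X σ ∧ c = Y σ then 1 else 0)
    (fun σ b c => by positivity) (fun σ σ' h => by simp only [hA σ σ' h, hX σ σ' h, hY σ σ' h])
  rw [mass_eq, mass_eq]
  refine le_of_le_of_eq this ?_
  congr! 3 with σ
  by_cases h : A σ <;> simp [h, ite_and]

lemma mass_and_fst_le (hv : ∀ a, #{p | v p = a} = d) (hd : 1 ≤ d)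
    (hm : 28 * d ≤ Fintype.card V) (ht : 0 ≤ t) (ht1 : t ≤ 1) {j : P} {B : Finset P}
    (hj : j ∉ B) (hB : #B ≤ 4) {A : Perm P × Perm P → Prop} {X : Perm P × Perm P → V}
    (hA : DeterminedBy v B A) (hX : DeterminedBy v B X) :
    mass v t (fun σ => A σ ∧ v (σ.1 j) = X σ) ≤ 2 / (Fintype.card V : ℝ) * mass v t A := by
  classical
  have := sum_weight_mul_le_two_div hv hd hm ht ht1 hj hB
    (F := fun σ b _ => if A σ ∧ b = X σ then 1 else 0)
    (fun σ b c => by positivity) (fun σ σ' h => by simp only [hA σ σ' h, hX σ σ' h])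
  have hm0 : (Fintype.card V : ℝ) ≠ 0 := by
    have : Fintype.card V ≠ 0 := by lia
    exact_mod_cast this
  rw [mass_eq, mass_eq]
  refine le_of_le_of_eq this ?_
  rw [mul_sum, mul_sum]
  refine sum_congr rfl fun σ _ => ?_
  by_cases h : A σ
  · simp [h]; field_simp
  · simp [h]

lemma mass_and_snd_le (hv : ∀ a, #{p | v p = a} = d) (hd : 1 ≤ d)
    (hm : 28 * d ≤ Fintype.card V) (ht : 0 ≤ t) (ht1 : t ≤ 1) {j : P} {B : Finset P}
    (hj : j ∉ B) (hB : #B ≤ 4) {A : Perm P × Perm P → Prop} {Y : Perm P × Perm P → V}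
    (hA : DeterminedBy v B A) (hY : DeterminedBy v B Y) :
    mass v t (fun σ => A σ ∧ v (σ.2 j) = Y σ) ≤ 2 / (Fintype.card V : ℝ) * mass v t A := by
  classical
  have := sum_weight_mul_le_two_div hv hd hm ht ht1 hj hB
    (F := fun σ _ c => if A σ ∧ c = Y σ then 1 else 0)
    (fun σ b c => by positivity) (fun σ σ' h => by simp only [hA σ σ' h, hY σ σ' h])
  have hm0 : (Fintype.card V : ℝ) ≠ 0 := by
    have : Fintype.card V ≠ 0 := by lia
    exact_mod_cast this
  rw [mass_eq, mass_eq]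
  refine le_of_le_of_eq this ?_
  rw [mul_sum, mul_sum]
  refine sum_congr rfl fun σ _ => ?_
  by_cases h : A σ
  · simp [h]; field_simp
  · simp [h]

variable {i j f g h : P}

lemma mass_fst_snd_le (hv : ∀ a, #{p | v p = a} = d) (hd : 1 ≤ d)
    (hm : 28 * d ≤ Fintype.card V) (ht : 0 ≤ t) (ht1 : t ≤ 1)
    (hfi : f ≠ i) (hgi : g ≠ i) (hfg : f ≠ g) :
    mass v t (fun σ => v (σ.1 f) = v (σ.1 i) ∧ v (σ.2 g) = v (σ.2 i)) ≤
      4 / (Fintype.card V : ℝ) ^ 2 * totalMass v t := by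
  have h1 := mass_and_fst_le hv hd hm ht ht1 (j := f) (B := {i}) (by simpa using hfi) (by simp)
    (A := fun _ => True) (X := fun σ => v (σ.1 i)) (fun _ _ _ => rfl)
    (fun σ σ' h => by simp_all [edge])
  have h2 := mass_and_snd_le hv hd hm ht ht1 (j := g) (B := {i, f})
    (by simp [hgi, hfg.symm]) (card_le_two.trans (by norm_num))
    (A := fun σ => v (σ.1 f) = v (σ.1 i)) (Y := fun σ => v (σ.2 i))
    (fun σ σ' h => by simp_all [edge]) (fun σ σ' h => by simp_all [edge])
  rw [mass_true] at h1
  simp only [true_and] at h1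
  calc _ ≤ _ := h2
    _ ≤ 2 / (Fintype.card V : ℝ) * (2 / (Fintype.card V : ℝ) * totalMass v t) := by gcongr
    _ = _ := by ring

lemma mass_fst_snd_and_le (hv : ∀ a, #{p | v p = a} = d) (hd : 1 ≤ d)
    (hm : 28 * d ≤ Fintype.card V) (ht : 0 ≤ t) (ht1 : t ≤ 1)
    (hfi : f ≠ i) (hgi : g ≠ i) (hfg : f ≠ g) (hi : h ≠ i) (hj : h ≠ j) (hf : h ≠ f) (hg : h ≠ g)
    {X Y : Perm P × Perm P → V} (hX : DeterminedBy v {i, j, f, g} X)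
    (hY : DeterminedBy v {i, j, f, g} Y) :
    mass v t (fun σ => (v (σ.1 f) = v (σ.1 i) ∧ v (σ.2 g) = v (σ.2 i)) ∧
        v (σ.1 h) = X σ ∧ v (σ.2 h) = Y σ) ≤
      8 / (Fintype.card V : ℝ) ^ 4 * totalMass v t := by
  have h1 := mass_and_both_le hv hd hm ht ht1 (j := h) (B := {i, j, f, g})
    (by simp [*]) card_le_four
    (A := fun σ => v (σ.1 f) = v (σ.1 i) ∧ v (σ.2 g) = v (σ.2 i))
    (fun σ σ' h => by simp_all [edge]) hX hY
  have h2 := mass_fst_snd_le hv hd hm ht ht1 hfi hgi hfg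
  calc _ ≤ _ := h1
    _ ≤ 2 / (Fintype.card V : ℝ) ^ 2 * (4 / (Fintype.card V : ℝ) ^ 2 * totalMass v t) := by gcongr
    _ = _ := by ring

lemma mass_edge_eq_le (hv : ∀ a, #{p | v p = a} = d) (hd : 1 ≤ d)
    (hm : 28 * d ≤ Fintype.card V) (ht : 0 ≤ t) (ht1 : t ≤ 1) (hi : h ≠ i) :
    mass v t (fun σ => edge v σ h = edge v σ i) ≤
      2 / (Fintype.card V : ℝ) ^ 2 * totalMass v t := by
  have h1 := mass_and_both_le hv hd hm ht ht1 (j := h) (B := {i}) (by simpa using hi) (by simp)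
    (A := fun _ => True) (X := fun σ => v (σ.1 i)) (Y := fun σ => v (σ.2 i)) (fun _ _ _ => rfl)
    (fun σ σ' h => by simp_all [edge]) (fun σ σ' h => by simp_all [edge])
  rw [mass_true] at h1
  refine (mass_mono ht fun σ hσ => ?_).trans h1
  simpa [edge] using (Prod.ext_iff.1 hσ).2

/-- Upper bound for the weighted probability of a coincidence. -/
lemma mass_edge_eq_le_sq (hv : ∀ a, #{p | v p = a} = d) (ht : 0 ≤ t) (ht1 : t ≤ 1) (hij : i ≠ j) :
    ((Fintype.card P : ℝ) ^ 2 - (2 * Fintype.card P + 3 * (Fintype.card P * d) + 3 * d ^ 3)) *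
      mass v t (fun σ => edge v σ i = edge v σ j) ≤ t ^ 2 * d ^ 2 * totalMass v t := by
  classical
  by_cases hvij : v i = v j
  swap
  · have : mass v t (fun σ => edge v σ i = edge v σ j) = 0 := by
      simp [mass, edge, hvij]
    rw [this, mul_zero]
    exact mul_nonneg (by positivity) (totalMass_nonneg ht)
  have := sum_weight_mul_le hv ht (sq_nonneg t) (j := j) (B := {i}) (by simpa using hij.symm)
    (F := fun σ b c => if b = v (σ.1 i) ∧ c = v (σ.2 i) then 1 else 0)
    (fun σ b c => by positivity) (fun σ σ' h => by simp_all [edge])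
    (fun σ f g hs hb h0 => weight_le_sq_mul_weight_rotate ht ht1 hs hb hij (by
      simp only [ne_eq, ite_eq_right_iff, one_ne_zero, imp_false, not_not] at h0
      simp [edge, hvij, h0]))
  simp only [card_singleton, Nat.cast_one, one_mul] at this
  convert this using 1
  · congr 1
    simp only [mass, edge, hvij, Prod.mk.injEq, true_and]
    simp only [eq_comm]
  · congr 1
    simp [totalMass, ite_and]

end Mass

section LowerBound

variable {P V : Type*} [Fintype P] [DecidableEq P] [DecidableEq V]

open Classical in
/-- The pairs `(f, g)` such that switching at `j`, `f`, `g` makes the edges at `i` and `j`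
coincide and creates no other coincidence. -/
noncomputable def merging (v : P → V) (σ : Perm P × Perm P) (i j : P) : Finset (P × P) :=
  {x | (v (σ.1 x.1) = v (σ.1 i) ∧ v (σ.2 x.2) = v (σ.2 i)) ∧ Separated v j x.1 x.2 ∧
    ∀ k, k ≠ j → k ≠ x.1 → k ≠ x.2 →
      (k ≠ i → edge v σ k ≠ (v j, v (σ.1 x.1), v (σ.2 x.2))) ∧
      edge v σ k ≠ (v x.1, v (σ.1 x.2), v (σ.2 j)) ∧
      edge v σ k ≠ (v x.2, v (σ.1 j), v (σ.2 x.1))}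

/-- Pairs of positions distinct from `i` whose first endpoints conflict with `j`. -/
def conflicts (v : P → V) (i j : P) : Finset (P × P) :=
  {x | (x.1 ≠ i ∧ x.2 ≠ i ∧ x.1 ≠ x.2) ∧ (v j = v x.1 ∨ v j = v x.2 ∨ v x.1 = v x.2)}

/-- Triples `((f, g), h)` with `h` and `f` sharing their first endpoint. -/
def linkedFst (v : P → V) (i j : P) : Finset ((P × P) × P) :=
  {y | (y.1.1 ≠ i ∧ y.1.2 ≠ i ∧ y.1.1 ≠ y.1.2 ∧ y.2 ≠ i ∧ y.2 ≠ j ∧ y.2 ≠ y.1.1 ∧ y.2 ≠ y.1.2) ∧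
    v y.2 = v y.1.1}

/-- Triples `((f, g), h)` with `h` and `g` sharing their first endpoint. -/
def linkedSnd (v : P → V) (i j : P) : Finset ((P × P) × P) :=
  {y | (y.1.1 ≠ i ∧ y.1.2 ≠ i ∧ y.1.1 ≠ y.1.2 ∧ y.2 ≠ i ∧ y.2 ≠ j ∧ y.2 ≠ y.1.1 ∧ y.2 ≠ y.1.2) ∧
    v y.2 = v y.1.2}

variable {v : P → V} {d : ℕ} {t : ℝ} {i j : P}

lemma mem_merging {σ : Perm P × Perm P} {x : P × P} : x ∈ merging v σ i j ↔
    (v (σ.1 x.1) = v (σ.1 i) ∧ v (σ.2 x.2) = v (σ.2 i)) ∧ Separated v j x.1 x.2 ∧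
    ∀ k, k ≠ j → k ≠ x.1 → k ≠ x.2 →
      (k ≠ i → edge v σ k ≠ (v j, v (σ.1 x.1), v (σ.2 x.2))) ∧
      edge v σ k ≠ (v x.1, v (σ.1 x.2), v (σ.2 j)) ∧
      edge v σ k ≠ (v x.2, v (σ.1 j), v (σ.2 x.1)) := by
  simp only [merging, mem_filter, mem_univ, true_and]

lemma card_conflicts_le (hv : ∀ a, #{p | v p = a} = d) :
    #(conflicts v i j) ≤ 3 * (Fintype.card P * d) :=
  (card_le_card (monotone_filter_right _ fun _ _ h => h.2)).trans (card_not_separated_le hv j)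

lemma card_filter_link_le (hv : ∀ a, #{p | v p = a} = d) (φ : P × P → P) :
    #{y : (P × P) × P | v y.2 = v (φ y.1)} ≤ Fintype.card P ^ 2 * d := by
  have hsub : ({y : (P × P) × P | v y.2 = v (φ y.1)} : Finset ((P × P) × P)) ⊆
      univ.biUnion fun x => {x} ×ˢ ({h | v h = v (φ x)} : Finset P) := by
    rintro ⟨x, h⟩
    simp
  refine (card_le_card hsub).trans ((card_biUnion_le_card_mul _ _ d fun x _ => ?_).trans_eq ?_)
  · simp [hv]
  · simp [sq]

lemma card_linkedFst_le (hv : ∀ a, #{p | v p = a} = d) :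
    #(linkedFst v i j) ≤ Fintype.card P ^ 2 * d :=
  (card_le_card (monotone_filter_right _ fun _ _ h => h.2)).trans
    (card_filter_link_le hv Prod.fst)

lemma card_linkedSnd_le (hv : ∀ a, #{p | v p = a} = d) :
    #(linkedSnd v i j) ≤ Fintype.card P ^ 2 * d :=
  (card_le_card (monotone_filter_right _ fun _ _ h => h.2)).trans
    (card_filter_link_le hv Prod.snd)

lemma sq_le_card_merging_add (hv : ∀ a, #{p | v p = a} = d) (hvij : v i = v j)
    (σ : Perm P × Perm P) :
    d ^ 2 ≤ #(merging v σ i j) + 3 * d +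
      d ^ 2 * #{h ∈ ({h | h ≠ i ∧ v h = v i} : Finset P) | edge v σ h = edge v σ i} +
      #{x ∈ conflicts v i j | v (σ.1 x.1) = v (σ.1 i) ∧ v (σ.2 x.2) = v (σ.2 i)} +
      #{y ∈ linkedFst v i j | (v (σ.1 y.1.1) = v (σ.1 i) ∧ v (σ.2 y.1.2) = v (σ.2 i)) ∧
        v (σ.1 y.2) = v (σ.1 y.1.2) ∧ v (σ.2 y.2) = v (σ.2 j)} +
      #{y ∈ linkedSnd v i j | (v (σ.1 y.1.1) = v (σ.1 i) ∧ v (σ.2 y.1.2) = v (σ.2 i)) ∧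
        v (σ.1 y.2) = v (σ.1 j) ∧ v (σ.2 y.2) = v (σ.2 y.1.1)} := by
  have h1 := card_filter_perm hv σ.1 (v (σ.1 i))
  have h2 := card_filter_perm hv σ.2 (v (σ.2 i))
  set F1 : Finset P := {p | v (σ.1 p) = v (σ.1 i)} with hF1
  set F2 : Finset P := {p | v (σ.2 p) = v (σ.2 i)} with hF2
  set D : Finset P := {h ∈ ({h | h ≠ i ∧ v h = v i} : Finset P) | edge v σ h = edge v σ i}
    with hD
  set S1 : Finset (P × P) :=
    {x ∈ conflicts v i j | v (σ.1 x.1) = v (σ.1 i) ∧ v (σ.2 x.2) = v (σ.2 i)} with hS1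
  set S2 : Finset ((P × P) × P) :=
    {y ∈ linkedFst v i j | (v (σ.1 y.1.1) = v (σ.1 i) ∧ v (σ.2 y.1.2) = v (σ.2 i)) ∧
        v (σ.1 y.2) = v (σ.1 y.1.2) ∧ v (σ.2 y.2) = v (σ.2 j)} with hS2
  set S3 : Finset ((P × P) × P) :=
    {y ∈ linkedSnd v i j | (v (σ.1 y.1.1) = v (σ.1 i) ∧ v (σ.2 y.1.2) = v (σ.2 i)) ∧
        v (σ.1 y.2) = v (σ.1 j) ∧ v (σ.2 y.2) = v (σ.2 y.1.1)} with hS3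
  have hsub : F1 ×ˢ F2 ⊆ merging v σ i j ∪ ({i} ×ˢ F2 ∪ (F1 ×ˢ {i} ∪ F1.image fun p => (p, p))) ∪
      (D.biUnion fun _ => F1 ×ˢ F2) ∪ S1 ∪ S2.image Prod.fst ∪ S3.image Prod.fst := by
    rintro ⟨f, g⟩ hx
    by_contra hnot
    simp only [mem_union, not_or] at hnot
    obtain ⟨⟨⟨⟨⟨n0, n1, n2, n3⟩, n4⟩, n5⟩, n6⟩, n7⟩ := hnot
    obtain ⟨hf, hg⟩ := mem_product.1 hx
    have hfi : f ≠ i := by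
      rintro rfl; exact n1 (mem_product.2 ⟨mem_singleton_self _, hg⟩)
    have hgi : g ≠ i := by
      rintro rfl; exact n2 (mem_product.2 ⟨hf, mem_singleton_self _⟩)
    have hfg : f ≠ g := by
      rintro rfl; exact n3 (mem_image.2 ⟨f, hf, rfl⟩)
    have hf' : v (σ.1 f) = v (σ.1 i) := by simpa [hF1] using hf
    have hg' : v (σ.2 g) = v (σ.2 i) := by simpa [hF2] using hg
    have hsep : Separated v j f g := by
      by_contra hs
      refine n5 (mem_filter.2 ⟨mem_filter.2 ⟨mem_univ _, ⟨hfi, hgi, hfg⟩, ?_⟩, hf', hg'⟩)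
      simp only [Separated] at hs
      tauto
    refine n0 (mem_merging.2 ⟨⟨hf', hg'⟩, hsep, fun k hkj hkf hkg => ⟨?_, ?_, ?_⟩⟩)
    · intro hki he
      refine n4 (mem_biUnion.2 ⟨k, mem_filter.2 ⟨mem_filter.2 ⟨mem_univ _, hki, ?_⟩, ?_⟩, hx⟩)
      · exact (congrArg Prod.fst he).trans hvij.symm
      · rw [he]
        simp [edge, hvij, hf', hg']
    · intro he
      simp only [edge, Prod.mk.injEq] at he
      refine n6 (mem_image.2 ⟨((f, g), k), mem_filter.2 ⟨mem_filter.2 ⟨mem_univ _,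
        ⟨hfi, hgi, hfg, ?_, hkj, hkf, hkg⟩, he.1⟩, ⟨hf', hg'⟩, he.2⟩, rfl⟩)
      rintro rfl
      exact hsep.1 (hvij.symm.trans he.1)
    · intro he
      simp only [edge, Prod.mk.injEq] at he
      refine n7 (mem_image.2 ⟨((f, g), k), mem_filter.2 ⟨mem_filter.2 ⟨mem_univ _,
        ⟨hfi, hgi, hfg, ?_, hkj, hkf, hkg⟩, he.1⟩, ⟨hf', hg'⟩, he.2⟩, rfl⟩)
      rintro rfl
      exact hsep.2.1 (hvij.symm.trans he.1)
  have hdeg : #({i} ×ˢ F2 ∪ (F1 ×ˢ {i} ∪ F1.image fun p => (p, p))) ≤ 3 * d := by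
    refine (card_union_le _ _).trans ((Nat.add_le_add_left (card_union_le _ _) _).trans ?_)
    have := card_image_le (s := F1) (f := fun p => (p, p))
    rw [card_product, card_product, card_singleton]
    lia
  have hdup : #(D.biUnion fun _ => F1 ×ˢ F2) ≤ d ^ 2 * #D :=
    (card_biUnion_le_card_mul _ _ (d ^ 2) fun _ _ => by
      rw [card_product, h1, h2, sq]).trans_eq (mul_comm _ _)
  have hcard : #(F1 ×ˢ F2) = d ^ 2 := by rw [card_product, h1, h2, sq]
  rw [← hcard]
  refine (card_le_card hsub).trans ?_
  refine (card_union_le _ _).trans (Nat.add_le_add ?_ card_image_le)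
  refine (card_union_le _ _).trans (Nat.add_le_add ?_ card_image_le)
  refine (card_union_le _ _).trans (Nat.add_le_add_right ?_ _)
  refine (card_union_le _ _).trans (Nat.add_le_add ?_ (hdup.trans_eq (by rw [hcard])))
  exact (card_union_le _ _).trans (Nat.add_le_add_left hdeg _)

lemma sum_weight_mul_card_merging_le (ht : 0 ≤ t) (ht1 : t ≤ 1) (hvij : v i = v j) :
    t ^ 2 * ∑ σ, weight v t σ * (#(merging v σ i j) : ℝ) ≤
      (Fintype.card P : ℝ) ^ 2 * mass v t (fun σ => edge v σ i = edge v σ j) := by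
  classical
  rw [mass_eq]
  calc _ = ∑ σ, ∑ x ∈ merging v σ i j, t ^ 2 * weight v t σ := by
        rw [mul_sum]
        refine sum_congr rfl fun σ _ => ?_
        rw [sum_const, nsmul_eq_mul]
        ring
    _ ≤ ∑ σ, ∑ x : P × P, weight v t (rotate j x.1 x.2 σ) *
          if edge v (rotate j x.1 x.2 σ) i = edge v (rotate j x.1 x.2 σ) j then 1 else 0 := by
        refine sum_le_sum fun σ _ => ?_
        refine le_trans (sum_le_sum fun x hx => ?_) (sum_le_univ_sum_of_nonneg fun x =>
          mul_nonneg (weight_nonneg ht) (by positivity))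
        obtain ⟨⟨h1, h2⟩, hs, hb⟩ := mem_merging.1 hx
        rw [if_pos, mul_one]
        · exact sq_mul_weight_le_weight_rotate ht ht1 hs hb
        · by_cases hij : i = j
          · rw [hij]
          rw [edge_rotate_fst hs, edge_rotate_of_ne hij]
          · simp [edge, hvij, h1, h2]
          · rintro rfl; exact hs.1 hvij.symm
          · rintro rfl; exact hs.2.1 hvij.symm
    _ = ∑ x : P × P, ∑ σ, weight v t σ * if edge v σ i = edge v σ j then 1 else 0 := by
        rw [sum_comm]
        refine sum_congr rfl fun x _ => ?_
        exact Equiv.sum_comp (rotate j x.1 x.2)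
          (fun σ => weight v t σ * if edge v σ i = edge v σ j then 1 else 0)
    _ = _ := by
        rw [sum_const, card_univ, Fintype.card_prod, nsmul_eq_mul]
        push_cast
        ring

variable [Fintype V]

/-- Lower bound for the weighted probability of a coincidence. -/
lemma sq_mul_totalMass_le_mass_edge_eq (hv : ∀ a, #{p | v p = a} = d) (hd : 1 ≤ d)
    (hm : 28 * d ≤ Fintype.card V) (ht : 0 ≤ t) (ht1 : t ≤ 1) (hvij : v i = v j) :
    t ^ 2 * (((d : ℝ) ^ 2 - (3 * d + 12 * d ^ 2 / Fintype.card V +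
      18 * d ^ 3 / (Fintype.card V : ℝ) ^ 2)) * totalMass v t) ≤
      (Fintype.card V * d : ℝ) ^ 2 * mass v t (fun σ => edge v σ i = edge v σ j) := by
  have hN : (Fintype.card P : ℝ) = Fintype.card V * d := by exact_mod_cast card_eq_mul hv
  have hmain := sum_weight_mul_card_merging_le (v := v) (i := i) (j := j) ht ht1 hvij
  rw [hN] at hmain
  refine le_trans (mul_le_mul_of_nonneg_left ?_ (sq_nonneg t)) hmain
  have hZ := totalMass_nonneg (v := v) ht
  have hm0 : 0 < (Fintype.card V : ℝ) := by
    have : 0 < Fintype.card V := by lia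
    exact_mod_cast this
  set m : ℝ := (Fintype.card V : ℝ)
  have b1 : ∑ σ, weight v t σ *
      (#{h ∈ ({h | h ≠ i ∧ v h = v i} : Finset P) | edge v σ h = edge v σ i} : ℝ) ≤
      d * (2 / m ^ 2 * totalMass v t) := by
    rw [sum_weight_mul_card _ fun h σ => edge v σ h = edge v σ i]
    refine (sum_le_card_nsmul _ _ (2 / m ^ 2 * totalMass v t) fun h hh => ?_).trans ?_
    · exact mass_edge_eq_le hv hd hm ht ht1 (mem_filter.1 hh).2.1
    · rw [nsmul_eq_mul]
      refine mul_le_mul_of_nonneg_right ?_ (by positivity)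
      rw [← hv (v i)]
      exact Nat.cast_le.2 (card_le_card fun h hh =>
        mem_filter.2 ⟨mem_univ _, (mem_filter.1 hh).2.2⟩)
  have b2 : ∑ σ, weight v t σ * (#{x ∈ conflicts v i j |
      v (σ.1 x.1) = v (σ.1 i) ∧ v (σ.2 x.2) = v (σ.2 i)} : ℝ) ≤
      (3 * (m * d * d)) * (4 / m ^ 2 * totalMass v t) := by
    rw [sum_weight_mul_card (conflicts v i j)
      (fun x σ => v (σ.1 x.1) = v (σ.1 i) ∧ v (σ.2 x.2) = v (σ.2 i))]
    refine (sum_le_card_nsmul _ _ (4 / m ^ 2 * totalMass v t) fun x hx => ?_).trans ?_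
    · obtain ⟨h1, h2, h3⟩ := (mem_filter.1 hx).2.1
      exact mass_fst_snd_le hv hd hm ht ht1 h1 h2 h3
    · rw [nsmul_eq_mul, ← hN]
      refine mul_le_mul_of_nonneg_right ?_ (by positivity)
      exact_mod_cast card_conflicts_le hv
  have b3 : ∑ σ, weight v t σ * (#{y ∈ linkedFst v i j |
      (v (σ.1 y.1.1) = v (σ.1 i) ∧ v (σ.2 y.1.2) = v (σ.2 i)) ∧
        v (σ.1 y.2) = v (σ.1 y.1.2) ∧ v (σ.2 y.2) = v (σ.2 j)} : ℝ) ≤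
      ((m * d) ^ 2 * d) * (8 / m ^ 4 * totalMass v t) := by
    rw [sum_weight_mul_card (linkedFst v i j)
      (fun y σ => (v (σ.1 y.1.1) = v (σ.1 i) ∧ v (σ.2 y.1.2) = v (σ.2 i)) ∧
        v (σ.1 y.2) = v (σ.1 y.1.2) ∧ v (σ.2 y.2) = v (σ.2 j))]
    refine (sum_le_card_nsmul _ _ (8 / m ^ 4 * totalMass v t) fun y hy => ?_).trans ?_
    · obtain ⟨h1, h2, h3, h4, h5, h6, h7⟩ := (mem_filter.1 hy).2.1
      exact mass_fst_snd_and_le hv hd hm ht ht1 h1 h2 h3 h4 h5 h6 h7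
        (fun σ σ' h => by simp_all [edge]) (fun σ σ' h => by simp_all [edge])
    · rw [nsmul_eq_mul, ← hN]
      refine mul_le_mul_of_nonneg_right ?_ (by positivity)
      exact_mod_cast card_linkedFst_le hv
  have b4 : ∑ σ, weight v t σ * (#{y ∈ linkedSnd v i j |
      (v (σ.1 y.1.1) = v (σ.1 i) ∧ v (σ.2 y.1.2) = v (σ.2 i)) ∧
        v (σ.1 y.2) = v (σ.1 j) ∧ v (σ.2 y.2) = v (σ.2 y.1.1)} : ℝ) ≤
      ((m * d) ^ 2 * d) * (8 / m ^ 4 * totalMass v t) := by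
    rw [sum_weight_mul_card (linkedSnd v i j)
      (fun y σ => (v (σ.1 y.1.1) = v (σ.1 i) ∧ v (σ.2 y.1.2) = v (σ.2 i)) ∧
        v (σ.1 y.2) = v (σ.1 j) ∧ v (σ.2 y.2) = v (σ.2 y.1.1))]
    refine (sum_le_card_nsmul _ _ (8 / m ^ 4 * totalMass v t) fun y hy => ?_).trans ?_
    · obtain ⟨h1, h2, h3, h4, h5, h6, h7⟩ := (mem_filter.1 hy).2.1
      exact mass_fst_snd_and_le hv hd hm ht ht1 h1 h2 h3 h4 h5 h6 h7
        (fun σ σ' h => by simp_all [edge]) (fun σ σ' h => by simp_all [edge])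
    · rw [nsmul_eq_mul, ← hN]
      refine mul_le_mul_of_nonneg_right ?_ (by positivity)
      exact_mod_cast card_linkedSnd_le hv
  have hsum := sum_le_sum fun σ (_ : σ ∈ univ) => mul_le_mul_of_nonneg_left
    ((Nat.cast_le (α := ℝ)).2 (sq_le_card_merging_add hv hvij σ))
    (weight_nonneg (v := v) (σ := σ) ht)
  push_cast at hsum
  simp only [mul_add, sum_add_distrib, mul_left_comm _ ((d : ℝ) ^ 2), ← mul_sum, ← sum_mul] at hsum
  have b1' := mul_le_mul_of_nonneg_left b1 (sq_nonneg (d : ℝ))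
  have e : 3 * (d : ℝ) * totalMass v t + d ^ 2 * (d * (2 / m ^ 2 * totalMass v t)) +
      (3 * (m * d * d)) * (4 / m ^ 2 * totalMass v t) +
      ((m * d) ^ 2 * d) * (8 / m ^ 4 * totalMass v t) +
      ((m * d) ^ 2 * d) * (8 / m ^ 4 * totalMass v t) =
      (3 * d + 12 * d ^ 2 / m + 18 * d ^ 3 / m ^ 2) * totalMass v t := by
    field_simp
    ring
  simp only [totalMass] at *
  linarith

end LowerBound

section Derivative

/-- A Grönwall inequality for `f' ≤ c t f` on the unit interval. -/
lemma le_mul_exp_of_hasDerivAt {f f' : ℝ → ℝ} {c : ℝ} (hf : ∀ t, HasDerivAt f (f' t) t)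
    (h : ∀ t ∈ Set.Ioo (0 : ℝ) 1, f' t ≤ c * t * f t) : f 1 ≤ f 0 * Real.exp (c / 2) := by
  have hg : ∀ t, HasDerivAt (fun t => f t * Real.exp (-(c / 2 * t ^ 2)))
      ((f' t - c * t * f t) * Real.exp (-(c / 2 * t ^ 2))) t := by
    intro t
    refine ((hf t).fun_mul ((hasDerivAt_pow 2 t).const_mul (c / 2)).fun_neg.exp).congr_deriv ?_
    push_cast
    ring
  have hanti : AntitoneOn (fun t => f t * Real.exp (-(c / 2 * t ^ 2))) (Set.Icc 0 1) := by
    refine antitoneOn_of_deriv_nonpos (convex_Icc 0 1)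
      (fun t _ => (hg t).continuousAt.continuousWithinAt)
      (fun t _ => (hg t).differentiableAt.differentiableWithinAt) fun t ht => ?_
    rw [interior_Icc] at ht
    rw [(hg t).deriv]
    exact mul_nonpos_of_nonpos_of_nonneg (sub_nonpos.2 (h t ht)) (Real.exp_pos _).le
  have := hanti (Set.left_mem_Icc.2 zero_le_one) (Set.right_mem_Icc.2 zero_le_one) zero_le_one
  simp only [one_pow, mul_one, ne_eq, OfNat.ofNat_ne_zero, not_false_eq_true, zero_pow, mul_zero,
    neg_zero, Real.exp_zero, Real.exp_neg] at this
  rwa [← div_eq_mul_inv, div_le_iff₀ (Real.exp_pos _)] at this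

variable {P V : Type*} [Fintype P] [DecidableEq P] [DecidableEq V] {v : P → V} {d : ℕ} {t : ℝ}

lemma hasDerivAt_totalMass (t : ℝ) : HasDerivAt (totalMass v)
    (∑ σ, ((coincidences v σ).card : ℝ) * t ^ ((coincidences v σ).card - 1)) t :=
  HasDerivAt.fun_sum fun _ _ => hasDerivAt_pow _ t

lemma coincidences_eq (σ : Perm P × Perm P) : coincidences v σ =
    {x ∈ ({x | x.1 ≠ x.2 ∧ v x.1 = v x.2} : Finset (P × P)) | edge v σ x.1 = edge v σ x.2} := by
  ext x
  simp only [mem_coincidences, mem_filter, mem_univ, true_and, edge, Prod.mk.injEq]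
  tauto

lemma mul_deriv_totalMass (t : ℝ) :
    t * ∑ σ, ((coincidences v σ).card : ℝ) * t ^ ((coincidences v σ).card - 1) =
      ∑ x ∈ ({x | x.1 ≠ x.2 ∧ v x.1 = v x.2} : Finset (P × P)),
        mass v t (fun σ => edge v σ x.1 = edge v σ x.2) := by
  rw [← sum_weight_mul_card _ fun (x : P × P) σ => edge v σ x.1 = edge v σ x.2, mul_sum]
  refine sum_congr rfl fun σ _ => ?_
  rw [← coincidences_eq, weight]
  rcases Nat.eq_zero_or_pos (coincidences v σ).card with h | h
  · simp [h]
  · rw [mul_left_comm, mul_pow_sub_one h.ne', mul_comm]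

lemma card_ne_and_eq (hv : ∀ a, #{p | v p = a} = d) :
    (#{x : P × P | x.1 ≠ x.2 ∧ v x.1 = v x.2} : ℝ) = Fintype.card P * (d - 1) := by
  have h1 : ({x : P × P | x.1 ≠ x.2 ∧ v x.1 = v x.2} : Finset (P × P)) =
      ({x : P × P | v x.1 = v x.2} : Finset (P × P)) \ univ.image fun p => (p, p) := by
    ext ⟨p, q⟩
    simp only [mem_filter, mem_univ, true_and, Finset.mem_sdiff, mem_image, Prod.mk.injEq,
      not_exists, not_and]
    constructor
    · rintro ⟨h, h'⟩
      exact ⟨h', fun a ha hb => h (ha.symm.trans hb)⟩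
    · rintro ⟨h, h'⟩
      exact ⟨fun e => h' p rfl e, h⟩
  have h2 : (univ.image fun p : P => (p, p)) ⊆ ({x : P × P | v x.1 = v x.2} : Finset (P × P)) := by
    simp [subset_iff]
  have h3 : #(univ.image fun p : P => (p, p)) = Fintype.card P := by
    rw [card_image_of_injective _ fun a b h => congrArg Prod.fst h, card_univ]
  have h4 := card_sdiff_add_card_eq_card h2
  rw [← h1, h3, card_filter_eq hv] at h4
  have h5 : (#{x : P × P | x.1 ≠ x.2 ∧ v x.1 = v x.2} : ℝ) + Fintype.card P =
    Fintype.card P * d := by exact_mod_cast h4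
  linarith

lemma totalMass_one : totalMass v 1 = ((Fintype.card P).factorial : ℝ) ^ 2 := by
  simp [totalMass, weight, Fintype.card_perm, sq]

lemma totalMass_zero :
    totalMass v 0 = Nat.card {σ : Perm P × Perm P // Function.Injective (edge v σ)} := by
  classical
  have h : ∀ σ : Perm P × Perm P, weight v 0 σ =
      if Function.Injective (edge v σ) then 1 else 0 := by
    intro σ
    have : #(coincidences v σ) = 0 ↔ Function.Injective (edge v σ) := by
      rw [card_eq_zero, eq_empty_iff_forall_notMem]
      simp only [mem_coincidences, not_and', not_not, Prod.forall]
      rfl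
    simp only [weight, zero_pow_eq, this]
  simp only [totalMass, h, sum_boole, Nat.card_eq_fintype_card, Fintype.card_subtype]

variable [Fintype V]

lemma mass_edge_eq_le_of_le (hv : ∀ a, #{p | v p = a} = d) (hd : 1 ≤ d)
    (hm : 28 * d ≤ Fintype.card V) (ht : 0 ≤ t) (ht1 : t ≤ 1) {i j : P} (hij : i ≠ j) :
    (Fintype.card V : ℝ) ^ 2 * mass v t (fun σ => edge v σ i = edge v σ j) ≤
      t ^ 2 * (1 + 12 / Fintype.card V) * totalMass v t := by
  have h := mass_edge_eq_le_sq hv ht ht1 hij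
  have hN : (Fintype.card P : ℝ) = Fintype.card V * d := by exact_mod_cast card_eq_mul hv
  have hd' : (1 : ℝ) ≤ d := by exact_mod_cast hd
  have hm' : 28 * (d : ℝ) ≤ Fintype.card V := by exact_mod_cast hm
  have hZ : 0 ≤ totalMass v t := totalMass_nonneg ht
  have hM : 0 ≤ mass v t (fun σ => edge v σ i = edge v σ j) :=
    sum_nonneg fun _ _ => mul_nonneg (weight_nonneg ht) (by split_ifs <;> simp)
  rw [hN] at h
  generalize mass v t (fun σ => edge v σ i = edge v σ j) = M at *
  generalize totalMass v t = Z at *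
  generalize (Fintype.card V : ℝ) = m at *
  generalize (d : ℝ) = d at *
  have hm0 : 0 < m := by linarith
  have h1 : (m ^ 2 - 6 * m) * M ≤ t ^ 2 * Z := by
    have e : d ^ 2 * ((m ^ 2 - 6 * m) * M) ≤ d ^ 2 * (t ^ 2 * Z) := by
      refine le_trans ?_ (h.trans_eq (by ring))
      rw [← mul_assoc]
      refine mul_le_mul_of_nonneg_right ?_ hM
      nlinarith [mul_nonneg (mul_nonneg hm0.le (zero_le_one.trans hd')) (sub_nonneg.2 hd'),
        mul_nonneg (sq_nonneg d) (sub_nonneg.2 hm')]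
    exact le_of_mul_le_mul_left e (by positivity)
  have h2 : m ^ 2 * M = (1 + 12 / m) * ((m ^ 2 - 6 * m) * M) - (6 * m - 72) * M := by
    field_simp
    ring
  have h3 : 0 ≤ (6 * m - 72) * M := mul_nonneg (by linarith) hM
  have h4 := mul_le_mul_of_nonneg_left h1 (by positivity : 0 ≤ 1 + 12 / m)
  linarith

lemma deriv_totalMass_le (hv : ∀ a, #{p | v p = a} = d) (hd : 1 ≤ d)
    (hm : 28 * d ≤ Fintype.card V) (ht : 0 < t) (ht1 : t ≤ 1) :
    ∑ σ, ((coincidences v σ).card : ℝ) * t ^ ((coincidences v σ).card - 1) ≤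
      ((d : ℝ) ^ 2 / Fintype.card V + 5 * (d / Fintype.card V)) * t * totalMass v t := by
  have hN : (Fintype.card P : ℝ) = Fintype.card V * d := by exact_mod_cast card_eq_mul hv
  have hd' : (1 : ℝ) ≤ d := by exact_mod_cast hd
  have hm' : 28 * (d : ℝ) ≤ Fintype.card V := by exact_mod_cast hm
  have hm0 : 0 < (Fintype.card V : ℝ) := by linarith
  have hZ : 0 ≤ totalMass v t := totalMass_nonneg ht.le
  have h := sum_le_card_nsmul ({x | x.1 ≠ x.2 ∧ v x.1 = v x.2} : Finset (P × P))
    (fun x => mass v t fun σ => edge v σ x.1 = edge v σ x.2)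
    (t ^ 2 * (1 + 12 / Fintype.card V) * totalMass v t / (Fintype.card V : ℝ) ^ 2) fun x hx => by
      rw [le_div_iff₀' (by positivity)]
      exact mass_edge_eq_le_of_le hv hd hm ht.le ht1 (mem_filter.1 hx).2.1
  rw [← mul_deriv_totalMass, nsmul_eq_mul, card_ne_and_eq hv, hN] at h
  refine le_of_mul_le_mul_left (h.trans ?_) ht
  generalize totalMass v t = Z at *
  generalize (Fintype.card V : ℝ) = m at *
  generalize (d : ℝ) = d at *
  have e : m * d * (d - 1) * (t ^ 2 * (1 + 12 / m) * Z / m ^ 2) =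
      (d * (d - 1) / m * (1 + 12 / m)) * (t ^ 2 * Z) := by
    field_simp
  rw [e, show t * ((d ^ 2 / m + 5 * (d / m)) * t * Z) =
    (d ^ 2 / m + 5 * (d / m)) * (t ^ 2 * Z) by ring]
  refine mul_le_mul_of_nonneg_right ?_ (by positivity)
  have : d ^ 2 / m + 5 * (d / m) - d * (d - 1) / m * (1 + 12 / m) =
      d * (6 * m - 12 * d + 12) / m ^ 2 := by
    field_simp
    ring
  have : 0 ≤ d * (6 * m - 12 * d + 12) / m ^ 2 :=
    div_nonneg (mul_nonneg (by linarith) (by linarith)) (by positivity)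
  linarith

lemma le_deriv_totalMass (hv : ∀ a, #{p | v p = a} = d) (hd : 1 ≤ d)
    (hm : 28 * d ≤ Fintype.card V) (ht : 0 < t) (ht1 : t ≤ 1) :
    ((d : ℝ) ^ 2 / Fintype.card V - 5 * (d / Fintype.card V)) * t * totalMass v t ≤
      ∑ σ, ((coincidences v σ).card : ℝ) * t ^ ((coincidences v σ).card - 1) := by
  have hN : (Fintype.card P : ℝ) = Fintype.card V * d := by exact_mod_cast card_eq_mul hv
  have hd' : (1 : ℝ) ≤ d := by exact_mod_cast hd
  have hm' : 28 * (d : ℝ) ≤ Fintype.card V := by exact_mod_cast hm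
  have hm0 : 0 < (Fintype.card V : ℝ) := by linarith
  have hd0 : 0 < (d : ℝ) := by linarith
  have hZ : 0 ≤ totalMass v t := totalMass_nonneg ht.le
  have h := card_nsmul_le_sum ({x | x.1 ≠ x.2 ∧ v x.1 = v x.2} : Finset (P × P))
    (fun x => mass v t fun σ => edge v σ x.1 = edge v σ x.2)
    (t ^ 2 * (((d : ℝ) ^ 2 - (3 * d + 12 * d ^ 2 / Fintype.card V +
      18 * d ^ 3 / (Fintype.card V : ℝ) ^ 2)) * totalMass v t) /
      (Fintype.card V * d : ℝ) ^ 2) fun x hx => by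
      rw [div_le_iff₀' (by positivity)]
      exact sq_mul_totalMass_le_mass_edge_eq hv hd hm ht.le ht1 (mem_filter.1 hx).2.2
  rw [← mul_deriv_totalMass, nsmul_eq_mul, card_ne_and_eq hv, hN] at h
  refine le_of_mul_le_mul_left (le_trans ?_ h) ht
  generalize totalMass v t = Z at *
  generalize (Fintype.card V : ℝ) = m at *
  generalize (d : ℝ) = d at *
  rw [show m * d * (d - 1) * (t ^ 2 * ((d ^ 2 - (3 * d + 12 * d ^ 2 / m + 18 * d ^ 3 / m ^ 2)) *
      Z) / (m * d) ^ 2) = (d ^ 2 / m - 5 * (d / m)) * (t ^ 2 * Z) + (d / m ^ 3) * (m ^ 2 + 3 * m ^ 2 / d -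
        12 * m * (d - 1) - 18 * d * (d - 1)) * (t ^ 2 * Z) by field_simp; ring,
    show t * ((d ^ 2 / m - 5 * (d / m)) * t * Z) = (d ^ 2 / m - 5 * (d / m)) * (t ^ 2 * Z) by ring]
  refine le_add_of_nonneg_right (mul_nonneg (mul_nonneg (by positivity) ?_) (by positivity))
  have : 0 ≤ 3 * m ^ 2 / d := by positivity
  nlinarith

/-- Two-sided bounds for the number of configurations whose edges are distinct. -/
lemma card_injective_bounds (hv : ∀ a, #{p | v p = a} = d) (hd : 1 ≤ d)
    (hm : 28 * d ≤ Fintype.card V) :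
    Real.exp (-(5 / 2 * (d / Fintype.card V))) * Real.exp (-(d : ℝ) ^ 2 / (2 * Fintype.card V)) *
      ((Fintype.card P).factorial : ℝ) ^ 2 ≤
      Nat.card {σ : Perm P × Perm P // Function.Injective (edge v σ)} ∧
    (Nat.card {σ : Perm P × Perm P // Function.Injective (edge v σ)} : ℝ) ≤
      Real.exp (5 / 2 * (d / Fintype.card V)) * Real.exp (-(d : ℝ) ^ 2 / (2 * Fintype.card V)) *
      ((Fintype.card P).factorial : ℝ) ^ 2 := by
  rw [← totalMass_zero, ← totalMass_one (v := v), ← Real.exp_add, ← Real.exp_add]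
  have h1 := le_mul_exp_of_hasDerivAt (hasDerivAt_totalMass (v := v)) fun t ht =>
    deriv_totalMass_le hv hd hm ht.1 ht.2.le
  have h2 := le_mul_exp_of_hasDerivAt (c := (d : ℝ) ^ 2 / Fintype.card V -
    5 * (d / Fintype.card V)) (fun t => (hasDerivAt_totalMass (v := v) t).fun_neg) fun t ht => by
      rw [mul_neg]
      exact neg_le_neg (le_deriv_totalMass hv hd hm ht.1 ht.2.le)
  rw [neg_mul, neg_le_neg_iff] at h2
  constructor
  · rw [show -(5 / 2 * (d / (Fintype.card V : ℝ))) + -(d : ℝ) ^ 2 / (2 * Fintype.card V) =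
      -(((d : ℝ) ^ 2 / Fintype.card V + 5 * (d / Fintype.card V)) / 2) by ring, Real.exp_neg,
      inv_mul_le_iff₀ (Real.exp_pos _)]
    linarith
  · rw [show 5 / 2 * (d / (Fintype.card V : ℝ)) + -(d : ℝ) ^ 2 / (2 * Fintype.card V) =
      -(((d : ℝ) ^ 2 / Fintype.card V - 5 * (d / Fintype.card V)) / 2) by ring, Real.exp_neg,
      le_inv_mul_iff₀ (Real.exp_pos _)]
    linarith

end Derivative

lemma card_filter_vmap {m d : ℕ} (a : Fin m) : #{s : Fin (m * d) | vmap s = a} = d := by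
  have h : #{s : Fin (m * d) | vmap s = a} = #(({a} : Finset (Fin m)) ×ˢ (univ : Finset (Fin d))) :=
    card_equiv finProdFinEquiv.symm fun s => by
      simp only [mem_filter, mem_univ, true_and, mem_product, mem_singleton, and_true]
      rfl
  simp [h]

end ConfigurationModel

/-- for `r = 3`, `m → ∞` and `2 ≤ d = o(m)`,
`P_3(d,m) = (1+o(1))·exp(−d²/(2m))`. -/
theorem configuration_model_simple_probability
    (d : ℕ → ℕ) (hd : ∀ m, 2 ≤ d m)
    (hdo : (fun m => (d m : ℝ)) =o[atTop] (fun m => (m : ℝ))) :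
    Tendsto (fun m => P3 m (d m) / Real.exp (-(d m : ℝ) ^ 2 / (2 * m)))
      atTop (nhds 1) := by
  have hx : Tendsto (fun m => 5 / 2 * ((d m : ℝ) / m)) atTop (nhds 0) := by
    simpa using hdo.tendsto_div_nhds_zero.const_mul (5 / 2)
  have hlow : Tendsto (fun m => Real.exp (-(5 / 2 * ((d m : ℝ) / m)))) atTop (nhds 1) := by
    simpa [Function.comp_def] using (Real.continuous_exp.tendsto _).comp hx.neg
  have hup : Tendsto (fun m => Real.exp (5 / 2 * ((d m : ℝ) / m))) atTop (nhds 1) := by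
    simpa [Function.comp_def] using (Real.continuous_exp.tendsto _).comp hx
  have hbd : ∀ᶠ m in atTop, 28 * d m ≤ m := by
    filter_upwards [hdo.bound (by norm_num : (0 : ℝ) < 1 / 28)] with m hm
    simp only [Real.norm_natCast] at hm
    have : 28 * (d m : ℝ) ≤ m := by linarith
    exact_mod_cast this
  have hb : ∀ᶠ m in atTop, Real.exp (-(5 / 2 * ((d m : ℝ) / m))) ≤
      P3 m (d m) / Real.exp (-(d m : ℝ) ^ 2 / (2 * m)) ∧
      P3 m (d m) / Real.exp (-(d m : ℝ) ^ 2 / (2 * m)) ≤ Real.exp (5 / 2 * ((d m : ℝ) / m)) := by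
    filter_upwards [hbd] with m hm
    have h := ConfigurationModel.card_injective_bounds (v := vmap (m := m) (d := d m))
      ConfigurationModel.card_filter_vmap
      (one_le_two.trans (hd m)) (by simpa using hm)
    simp only [Fintype.card_fin] at h
    have hf : (0 : ℝ) < ((m * d m).factorial : ℝ) ^ 2 := by positivity
    rw [le_div_iff₀ (Real.exp_pos _), div_le_iff₀ (Real.exp_pos _), P3, le_div_iff₀ hf,
      div_le_iff₀ hf]
    exact h
  exact tendsto_of_tendsto_of_tendsto_of_le_of_le' hlow hup (hb.mono fun _ h => h.1)
    (hb.mono fun _ h => h.2)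
end

section
/- Let r ≥ 3, m ≥ 1 be integers and let d be an integer with 1 ≤ d ≤ m^{r−1} − 1, and set λ = d/m^{r−1}, n = rm. Then H_r(d,m) = (2π)^{r−n−1} · (λ^λ (1−λ)^{1−λ})^{−m^r} · ∫_𝓑 F(θ) dθ, where the integral over 𝓑 is the (n−r+1)-dimensional integral over the coordinates θ_j, j ∈ [n] \ {2m, 3m, …, rm}, each ranging over [−π, π], with θ_{2m} = θ_{3m} = ⋯ = θ_{rm} = 0. -/
open MeasureTheory Filter

/-- The edge density `λ = d / m^(r-1)`. -/
noncomputable def lam (r m d : ℕ) : ℝ := (d : ℝ) / (m : ℝ) ^ (r - 1)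

/-- `Λ = λ(1−λ)`. -/
noncomputable def Lam (r m d : ℕ) : ℝ := lam r m d * (1 - lam r m d)

/-- For an edge `e ∈ (Fin m)^r` and `θ ∈ ℝ^n` (vertices indexed by `Fin r × Fin m`,
class `t` being `{t} × Fin m`), the sum `Σ_{j∈e} θ_j`. -/
def edgeSum (r m : ℕ) (θ : Fin r × Fin m → ℝ) (e : Fin r → Fin m) : ℝ :=
  ∑ t : Fin r, θ (t, e t)

/-- The integrand `F(θ) = (∏_e (1 + λ(e^{iΣ_{j∈e}θ_j} − 1))) · e^{−i d Σ_j θ_j}`. -/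
noncomputable def Ffun (r m d : ℕ) (θ : Fin r × Fin m → ℝ) : ℂ :=
  (∏ e : Fin r → Fin m,
      (1 + (lam r m d : ℂ) * (Complex.exp (Complex.I * (edgeSum r m θ e : ℂ)) - 1))) *
    Complex.exp (-Complex.I * (d : ℂ) * ((∑ p : Fin r × Fin m, θ p : ℝ) : ℂ))

/-- Vertex `p` is one of the constrained coordinates `2m, 3m, …, rm`
(the last vertex of each class except the first). -/
def constrained (r m : ℕ) (p : Fin r × Fin m) : Prop := p.1.val ≠ 0 ∧ p.2.val = m - 1

instance (r m : ℕ) : DecidablePred (constrained r m) :=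
  fun p => inferInstanceAs (Decidable (p.1.val ≠ 0 ∧ p.2.val = m - 1))

/-- Extension by zero of a vector of free coordinates to all of `ℝ^n`;
(n−r+1)-dimensional integrals over subsets of `𝓑` are realised by pulling back along it. -/
def ext (r m : ℕ) (θ : {p : Fin r × Fin m // ¬ constrained r m p} → ℝ) :
    Fin r × Fin m → ℝ :=
  fun p => if h : constrained r m p then 0 else θ ⟨p, h⟩

/-- `ρ₀ = r^{5/2} (log n) / (Λ m^{r−1})^{1/2}`, with `n = r·m`. -/
noncomputable def rho0 (r m d : ℕ) : ℝ :=
  (r : ℝ) ^ ((5 : ℝ) / 2) * Real.log ((r : ℝ) * m) /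
    Real.sqrt (Lam r m d * (m : ℝ) ^ (r - 1))

/-- `U_n(ρ) = {x ∈ ℝ^n : ‖x‖_∞ ≤ ρ}`. -/
def Uball (r m : ℕ) (ρ : ℝ) : Set (Fin r × Fin m → ℝ) := {θ | ∀ p, |θ p| ≤ ρ}

/-- `𝓑 = {θ ∈ U_n(π) : θ_{2m} = ⋯ = θ_{rm} = 0}`. -/
def BSet (r m : ℕ) : Set (Fin r × Fin m → ℝ) :=
  {θ | (∀ p, |θ p| ≤ Real.pi) ∧ ∀ p, constrained r m p → θ p = 0}

/-- The circular distance `|x|_{2π} = min_{k∈ℤ} |x − 2πk|`. -/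
noncomputable def circ (x : ℝ) : ℝ := ⨅ k : ℤ, |x - 2 * Real.pi * k|

/-- `Hcount r m d` is the number of `d`-regular `(r,r)`-graphs with classes of size `m`. -/
noncomputable def Hcount (r m d : ℕ) : ℕ :=
  Nat.card {E : Finset (Fin r → Fin m) //
    ∀ t : Fin r, ∀ v : Fin m, (E.filter (fun e => e t = v)).card = d}

/-- Orthogonality of the characters `x ↦ exp (i k x)` on `[-π, π]`. -/
theorem setIntegral_exp_I_mul_int (k : ℤ) :
    ∫ x in Set.Icc (-Real.pi) Real.pi, Complex.exp (Complex.I * (k : ℂ) * (x : ℂ)) =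
      if k = 0 then (2 * Real.pi : ℂ) else 0 := by
  rw [integral_Icc_eq_integral_Ioc,
    ← intervalIntegral.integral_of_le (by linarith [Real.pi_pos])]
  split_ifs with hk
  · subst hk
    simp
    ring
  · have hc : Complex.I * (k : ℂ) ≠ 0 := mul_ne_zero Complex.I_ne_zero (by exact_mod_cast hk)
    rw [integral_exp_mul_complex hc, div_eq_zero_iff]
    left
    rw [sub_eq_zero, Complex.exp_eq_exp_iff_exists_int]
    exact ⟨k, by push_cast; ring⟩

/-- The degree of the vertex `p` in the hypergraph `E`. -/
def vertexDegree {r m : ℕ} (E : Finset (Fin r → Fin m)) (p : Fin r × Fin m) : ℕ :=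
  (E.filter (fun e => e p.1 = p.2)).card

theorem sum_edgeSum {r m : ℕ} (E : Finset (Fin r → Fin m)) (θ : Fin r × Fin m → ℝ) :
    ∑ e ∈ E, edgeSum r m θ e = ∑ p, (vertexDegree E p : ℝ) * θ p := by
  unfold edgeSum vertexDegree
  rw [Finset.sum_comm, Fintype.sum_prod_type]
  refine Finset.sum_congr rfl fun t _ => ?_
  rw [← Finset.sum_fiberwise E (fun e => e t)]
  refine Finset.sum_congr rfl fun v _ => ?_
  rw [← nsmul_eq_mul]
  refine Finset.sum_eq_card_nsmul fun e he => ?_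
  rw [(Finset.mem_filter.mp he).2]

theorem sum_vertexDegree {r m : ℕ} (E : Finset (Fin r → Fin m)) (t : Fin r) :
    ∑ v, vertexDegree E (t, v) = E.card :=
  (Finset.card_eq_sum_card_fiberwise (f := fun e : Fin r → Fin m => e t)
    (fun _ _ => Finset.mem_coe.mpr (Finset.mem_univ _))).symm

theorem Ffun_eq_sum (r m d : ℕ) (θ : Fin r × Fin m → ℝ) :
    Ffun r m d θ = ∑ E : Finset (Fin r → Fin m),
      (lam r m d : ℂ) ^ E.card * (1 - (lam r m d : ℂ)) ^ (m ^ r - E.card) *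
        ∏ p, Complex.exp (Complex.I * (((vertexDegree E p : ℤ) - d : ℤ) : ℂ) * (θ p : ℂ)) := by
  have h (e : Fin r → Fin m) :
      1 + (lam r m d : ℂ) * (Complex.exp (Complex.I * (edgeSum r m θ e : ℂ)) - 1) =
        (lam r m d : ℂ) * Complex.exp (Complex.I * (edgeSum r m θ e : ℂ)) +
          (1 - (lam r m d : ℂ)) := by ring
  unfold Ffun
  simp_rw [h]
  rw [Finset.prod_add, Finset.powerset_univ, Finset.sum_mul]
  refine Finset.sum_congr rfl fun E _ => ?_
  rw [Finset.prod_mul_distrib, Finset.prod_const, Finset.prod_const,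
    ← Finset.compl_eq_univ_sdiff, Finset.card_compl, Fintype.card_fun, Fintype.card_fin,
    Fintype.card_fin, ← Complex.exp_sum, ← Complex.exp_sum, ← Finset.mul_sum,
    ← Complex.ofReal_sum, sum_edgeSum]
  have : Complex.exp (∑ p, Complex.I * (((vertexDegree E p : ℤ) - d : ℤ) : ℂ) * (θ p : ℂ)) =
      Complex.exp (Complex.I * ((∑ p, (vertexDegree E p : ℝ) * θ p : ℝ) : ℂ)) *
        Complex.exp (-Complex.I * (d : ℂ) * ((∑ p, θ p : ℝ) : ℂ)) := by
    rw [← Complex.exp_add]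
    congr 1
    push_cast
    rw [Finset.mul_sum, Finset.mul_sum, ← Finset.sum_add_distrib]
    exact Finset.sum_congr rfl fun p _ => by ring
  rw [this]
  ring

theorem prod_exp_ext {r m : ℕ} (k : Fin r × Fin m → ℤ)
    (θ : {p : Fin r × Fin m // ¬ constrained r m p} → ℝ) :
    ∏ p, Complex.exp (Complex.I * (k p : ℂ) * (ext r m θ p : ℂ)) =
      ∏ p : {p : Fin r × Fin m // ¬ constrained r m p},
        Complex.exp (Complex.I * (k p : ℂ) * (θ p : ℂ)) := by
  rw [← Fintype.prod_subtype_mul_prod_subtype (constrained r m), Finset.prod_eq_one, one_mul]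
  · refine Finset.prod_congr rfl fun p _ => ?_
    simp [ext, p.2]
  · intro p _
    simp [ext, p.2]

theorem setIntegral_prod_exp {ι : Type*} [Fintype ι] (k : ι → ℤ) :
    ∫ θ in Set.univ.pi (fun _ : ι => Set.Icc (-Real.pi) Real.pi),
        ∏ p, Complex.exp (Complex.I * (k p : ℂ) * (θ p : ℂ)) =
      if ∀ p, k p = 0 then (2 * Real.pi : ℂ) ^ Fintype.card ι else 0 := by
  rw [volume_pi, Measure.restrict_pi_pi,
    integral_fintype_prod_eq_prod (𝕜 := ℂ)
      (fun p x => Complex.exp (Complex.I * (k p : ℂ) * ((x : ℝ) : ℂ)))]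
  simp_rw [setIntegral_exp_I_mul_int]
  split_ifs with h
  · simp [h]
  · push Not at h
    obtain ⟨p, hp⟩ := h
    exact Finset.prod_eq_zero (Finset.mem_univ p) (if_neg hp)

theorem card_constrained (r m : ℕ) (hm : 1 ≤ m) :
    Fintype.card {p : Fin r × Fin m // constrained r m p} = r - 1 := by
  rcases r with _ | r
  · simp
  let f : {p : Fin (r + 1) × Fin m // constrained (r + 1) m p} ≃ {t : Fin (r + 1) // t ≠ 0} :=
    { toFun := fun p => ⟨p.1.1, fun h => p.2.1 (by simp [h])⟩
      invFun := fun t => ⟨(t.1, ⟨m - 1, by omega⟩), fun h => t.2 (Fin.ext h), rfl⟩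
      left_inv := fun p => Subtype.ext (Prod.ext rfl (Fin.ext p.2.2.symm))
      right_inv := fun t => rfl }
  rw [Fintype.card_congr f, Fintype.card_subtype_compl]
  simp

/-- Regularity at the unconstrained vertices forces regularity everywhere. -/
theorem vertexDegree_eq_of_free {r m d : ℕ} (hr : 1 ≤ r) (E : Finset (Fin r → Fin m))
    (h : ∀ p, ¬ constrained r m p → vertexDegree E p = d) : ∀ p, vertexDegree E p = d := by
  have hcard : E.card = m * d := by
    rw [← sum_vertexDegree E ⟨0, hr⟩,
      Finset.sum_congr rfl fun v _ => h (⟨0, hr⟩, v) (fun hc => hc.1 rfl)]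
    simp
  rintro ⟨t, v⟩
  by_cases hc : constrained r m (t, v)
  · have hsum := sum_vertexDegree E t
    have hother : ∀ w ∈ Finset.univ.erase v, vertexDegree E (t, w) = d := by
      intro w hw
      refine h _ fun hw' => (Finset.mem_erase.mp hw).1 (Fin.ext ?_)
      exact hw'.2.trans hc.2.symm
    rw [← Finset.add_sum_erase _ _ (Finset.mem_univ v), Finset.sum_congr rfl hother,
      Finset.sum_const, Finset.card_erase_of_mem (Finset.mem_univ v), Finset.card_univ,
      Fintype.card_fin, hcard, smul_eq_mul] at hsum
    obtain ⟨n, rfl⟩ : ∃ n, m = n + 1 := ⟨m - 1, by have := v.2; omega⟩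
    rw [Nat.add_sub_cancel] at hsum
    linarith
  · exact h _ hc

theorem card_eq_of_vertexDegree {r m d : ℕ} (hr : 1 ≤ r) (E : Finset (Fin r → Fin m))
    (h : ∀ p, vertexDegree E p = d) : E.card = m * d := by
  rw [← sum_vertexDegree E ⟨0, hr⟩]
  simp [h]

theorem Hcount_eq_card (r m d : ℕ) :
    Hcount r m d = (Finset.univ.filter
      fun E : Finset (Fin r → Fin m) => ∀ p, vertexDegree E p = d).card := by
  rw [Hcount, Nat.card_eq_fintype_card, Fintype.card_subtype]
  congr 1
  ext E
  simp [vertexDegree, Prod.forall]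

theorem setIntegral_Ffun (r m d : ℕ) (hr : 1 ≤ r) (hm : 1 ≤ m) :
    ∫ θ in Set.univ.pi
        (fun _ : {p : Fin r × Fin m // ¬ constrained r m p} => Set.Icc (-Real.pi) Real.pi),
      Ffun r m d (ext r m θ) =
    (Hcount r m d : ℂ) * ((lam r m d : ℂ) ^ (m * d) *
      (1 - (lam r m d : ℂ)) ^ (m ^ r - m * d) * (2 * Real.pi : ℂ) ^ (r * m - (r - 1))) := by
  simp_rw [Ffun_eq_sum, prod_exp_ext (fun p => (vertexDegree _ p : ℤ) - d)]
  rw [integral_finsetSum]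
  · simp_rw [integral_const_mul,
      setIntegral_prod_exp (fun p : {p : Fin r × Fin m // ¬ constrained r m p} =>
        (vertexDegree _ p.1 : ℤ) - d)]
    rw [Hcount_eq_card, ← nsmul_eq_mul, ← Finset.sum_const, Finset.sum_filter]
    refine Finset.sum_congr rfl fun E _ => ?_
    by_cases h : ∀ p, vertexDegree E p = d
    · rw [if_pos h, if_pos (fun p => by simp [h]), card_eq_of_vertexDegree hr E h,
        Fintype.card_subtype_compl, card_constrained r m hm, Fintype.card_prod,
        Fintype.card_fin, Fintype.card_fin]
    · rw [if_neg h, if_neg, mul_zero]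
      refine fun h' => h (vertexDegree_eq_of_free hr E fun p hp => ?_)
      have := h' ⟨p, hp⟩
      simp only at this
      omega
  · intro E _
    refine ContinuousOn.integrableOn_compact
      (isCompact_univ_pi fun _ => isCompact_Icc) (Continuous.continuousOn ?_)
    fun_prop

/-- the integral formula
`H_r(d,m) = (2π)^{r−n−1} (λ^λ (1−λ)^{1−λ})^{−m^r} ∫_𝓑 F(θ) dθ`, where the integral over
`𝓑` is the (n−r+1)-dimensional integral over the free coordinates, each in `[−π,π]`,
with the coordinates `2m, …, rm` set to zero. -/
theorem integral_formula_for_count (r m d : ℕ) (hr : 3 ≤ r) (hm : 1 ≤ m)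
    (hd1 : 1 ≤ d) (hd2 : d ≤ m ^ (r - 1) - 1) :
    (Hcount r m d : ℂ) =
      (((2 * Real.pi) ^ ((r : ℤ) - (r * m : ℕ) - 1) *
          (lam r m d ^ lam r m d * (1 - lam r m d) ^ (1 - lam r m d)) ^
            (-((m : ℝ) ^ r)) : ℝ) : ℂ) *
        ∫ θ in Set.univ.pi
            (fun _ : {p : Fin r × Fin m // ¬ constrained r m p} =>
              Set.Icc (-Real.pi) Real.pi),
          Ffun r m d (ext r m θ) := by
  have hm0 : (0 : ℝ) < m := by exact_mod_cast hm
  have hd : d < m ^ (r - 1) := by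
    have := Nat.pow_pos (n := r - 1) hm
    omega
  have hpow : m ^ r = m * m ^ (r - 1) := by
    rw [← pow_succ', Nat.sub_add_cancel (by omega)]
  have hle : m * d ≤ m ^ r := hpow ▸ Nat.mul_le_mul_left m hd.le
  have hl0 : 0 < lam r m d := div_pos (by exact_mod_cast hd1) (by positivity)
  have hl1 : 0 < 1 - lam r m d := by
    rw [sub_pos, lam, div_lt_one (by positivity)]
    exact_mod_cast hd
  have hexp : lam r m d * (m : ℝ) ^ r = ((m * d : ℕ) : ℝ) := by
    have : (m : ℝ) ^ r = m * (m : ℝ) ^ (r - 1) := by exact_mod_cast hpow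
    rw [lam, this]
    push_cast
    field_simp
  have hexp' : (1 - lam r m d) * (m : ℝ) ^ r = ((m ^ r - m * d : ℕ) : ℝ) := by
    rw [Nat.cast_sub hle, ← hexp]
    push_cast
    ring
  have hweight : (lam r m d ^ lam r m d * (1 - lam r m d) ^ (1 - lam r m d)) ^
      (-((m : ℝ) ^ r)) = (lam r m d ^ (m * d) * (1 - lam r m d) ^ (m ^ r - m * d))⁻¹ := by
    rw [Real.rpow_neg (by positivity), Real.mul_rpow (by positivity) (by positivity),
      ← Real.rpow_mul hl0.le, ← Real.rpow_mul hl1.le, hexp, hexp', Real.rpow_natCast,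
      Real.rpow_natCast]
  have hpi : (2 * Real.pi) ^ ((r : ℤ) - (r * m : ℕ) - 1) =
      ((2 * Real.pi) ^ (r * m - (r - 1)))⁻¹ := by
    rw [← zpow_natCast, ← zpow_neg]
    congr 1
    have : r ≤ r * m := Nat.le_mul_of_pos_right r hm
    omega
  rw [setIntegral_Ffun r m d (by omega) hm, hweight, hpi]
  have hl0' : (lam r m d : ℂ) ≠ 0 := by exact_mod_cast hl0.ne'
  have hl1' : 1 - (lam r m d : ℂ) ≠ 0 := by exact_mod_cast hl1.ne'
  have hpi' : (Real.pi : ℂ) ≠ 0 := by exact_mod_cast Real.pi_ne_zero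
  push_cast
  field_simp
end

section
/- For every real x and every λ ∈ [0,1], writing Λ = λ(1−λ), one has |1 + λ(e^{ix} − 1)| = √(1 − 2Λ(1 − cos x)), and this is at most exp(−(Λ/2)·(1 − |x|²_{2π}/12)·|x|²_{2π}), where |x|_{2π} := min_{k∈ℤ} |x − 2πk|. -/
/-- The circular distance is attained at some multiple of `2π`. -/
lemma exists_circ_eq (x : ℝ) : ∃ k : ℤ, circ x = |x - k * (2 * Real.pi)| := by
  have hp : (0 : ℝ) < 2 * Real.pi := Real.two_pi_pos
  have key : ∀ k : ℤ, |x - 2 * Real.pi * k| = 2 * Real.pi * |x / (2 * Real.pi) - k| := by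
    intro k
    rw [← abs_of_pos hp, ← abs_mul, abs_of_pos hp, mul_sub, mul_div_cancel₀ _ hp.ne']
  refine ⟨round (x / (2 * Real.pi)), ?_⟩
  rw [mul_comm _ (2 * Real.pi), circ]
  refine le_antisymm (ciInf_le ⟨0, ?_⟩ _) (le_ciInf fun k => ?_)
  · rintro _ ⟨k, rfl⟩
    exact abs_nonneg _
  · rw [key, key]
    exact mul_le_mul_of_nonneg_left (round_le _ _) hp.le

lemma Real.cos_le_one_sub_sq_add_pow_four (x : ℝ) :
    Real.cos x ≤ 1 - x ^ 2 / 2 + x ^ 4 / 24 := by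
  have hd : ∀ y : ℝ, HasDerivAt (fun t : ℝ => 1 - t ^ 2 / 2 + t ^ 4 / 24 - Real.cos t)
      (Real.sin y - (y - y ^ 3 / 6)) y := by
    intro y
    refine HasDerivAt.congr_deriv (((((hasDerivAt_pow 2 y).div_const 2).const_sub 1).add
      ((hasDerivAt_pow 4 y).div_const 24)).sub (Real.hasDerivAt_cos y)) ?_
    push_cast
    ring
  have hmono : MonotoneOn (fun t : ℝ => 1 - t ^ 2 / 2 + t ^ 4 / 24 - Real.cos t)
      (Set.Ici 0) := by
    refine monotoneOn_of_deriv_nonneg (convex_Ici 0)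
      (fun y _ => (hd y).continuousAt.continuousWithinAt)
      (fun y _ => (hd y).differentiableAt.differentiableWithinAt) fun y hy => ?_
    rw [(hd y).deriv]
    exact sub_nonneg.2 (Real.sin_ge_sub_cube (interior_subset hy))
  have h := hmono Set.self_mem_Ici (Set.mem_Ici.2 (abs_nonneg x)) (abs_nonneg x)
  have h4 : |x| ^ 4 = x ^ 4 := Even.pow_abs (by decide) x
  simp only [sq_abs, h4, Real.cos_abs, Real.cos_zero] at h
  linarith

/-- for every real `x` and `λ ∈ [0,1]`, with `Λ = λ(1−λ)`,
`|1 + λ(e^{ix} − 1)| = √(1 − 2Λ(1 − cos x))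
  ≤ exp(−(Λ/2)(1 − |x|²_{2π}/12)|x|²_{2π})`. -/
theorem abs_one_add_lam_exp_bound (x lam : ℝ) (hlam : lam ∈ Set.Icc (0 : ℝ) 1) :
    ‖(1 : ℂ) + (lam : ℂ) * (Complex.exp (Complex.I * (x : ℂ)) - 1)‖ =
      Real.sqrt (1 - 2 * (lam * (1 - lam)) * (1 - Real.cos x)) ∧
    Real.sqrt (1 - 2 * (lam * (1 - lam)) * (1 - Real.cos x)) ≤
      Real.exp (-(lam * (1 - lam) / 2) * (1 - circ x ^ 2 / 12) * circ x ^ 2) := by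
  constructor
  · have hz : (1 : ℂ) + (lam : ℂ) * (Complex.exp (Complex.I * (x : ℂ)) - 1) =
        ((1 + lam * (Real.cos x - 1) : ℝ) : ℂ) + ((lam * Real.sin x : ℝ) : ℂ) * Complex.I := by
      rw [mul_comm Complex.I, Complex.exp_mul_I]
      push_cast
      ring
    rw [hz, Complex.norm_add_mul_I]
    congr 1
    linear_combination lam ^ 2 * Real.sin_sq_add_cos_sq x
  · have hΛ : 0 ≤ lam * (1 - lam) := mul_nonneg hlam.1 (sub_nonneg.2 hlam.2)
    obtain ⟨k, hk⟩ := exists_circ_eq x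
    have hcos : Real.cos (circ x) = Real.cos x := by
      rw [hk, Real.cos_abs, Real.cos_sub_int_mul_two_pi]
    have hbound := Real.cos_le_one_sub_sq_add_pow_four (circ x)
    rw [hcos] at hbound
    refine Real.sqrt_le_iff.2 ⟨(Real.exp_pos _).le, ?_⟩
    rw [← Real.exp_nat_mul]
    calc 1 - 2 * (lam * (1 - lam)) * (1 - Real.cos x)
        ≤ Real.exp (-(2 * (lam * (1 - lam)) * (1 - Real.cos x))) := Real.one_sub_le_exp_neg _
      _ ≤ _ := by
        refine Real.exp_le_exp.2 ?_
        push_cast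
        linarith [mul_le_mul_of_nonneg_left hbound hΛ]
end
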